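/- arXiv:2012.09437 — 5 statements merged into one kernel-verified Lean document; each statement's English description precedes it below -/
import Mathlib

section
/- Under Assumptions 1–5, let k ∈ {1, …, K} be such that ℐ_k = {k} is a singleton. Then κ̲_k is an algebraically simple eigenvalue of 𝕄(z̲_k); moreover, if α_k > 0 then besides κ̲_k the matrix 𝕄(z̲_k) has exactly r − 1 eigenvalues in 𝔻 and exactly p eigenvalues in 𝒰, while if α_k < 0 it has exactly r eigenvalues in 𝔻 and exactly p − 1 eigenvalues in 𝒰 (all counted with algebraic multiplicity). -/
open scoped Classical
open Complex Filter Asymptotics Metric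

noncomputable section

set_option autoImplicit false

/-- the space `ℓ²(ℤ;ℂ)` -/
abbrev Seq2 : Type := lp (fun _ : ℤ => ℂ) 2

/-- the action of the convolution operator with coefficients `a` supported in `{-r, …, p}`:
`(Q u)_j = ∑_{ℓ=-r}^p a_ℓ u_{j+ℓ}`. -/
def convAct (r p : ℕ) (a : ℤ → ℂ) (u : ℤ → ℂ) (j : ℤ) : ℂ :=
  ∑ ℓ ∈ Finset.Icc (-(r : ℤ)) (p : ℤ), a ℓ * u (j + ℓ)

/-- the symbol `Q̂(κ) = ∑_{ℓ=-r}^p a_ℓ κ^ℓ`. -/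
def symbol (r p : ℕ) (a : ℤ → ℂ) (κ : ℂ) : ℂ :=
  ∑ ℓ ∈ Finset.Icc (-(r : ℤ)) (p : ℤ), a ℓ * κ ^ ℓ

/-- the symbol `F = Q̂₀ / Q̂₁` of the operator `ℒ = Q₁⁻¹ Q₀`. -/
def Fsym (r p : ℕ) (a0 a1 : ℤ → ℂ) (κ : ℂ) : ℂ :=
  symbol r p a0 κ / symbol r p a1 κ

/-- `𝔸_ℓ(z) = z a_{ℓ,1} - a_{ℓ,0}`. -/
def Acoef (a0 a1 : ℤ → ℂ) (ℓ : ℤ) (z : ℂ) : ℂ := z * a1 ℓ - a0 ℓ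

/-- the companion-type matrix `𝕄(z) ∈ M_{p+r}(ℂ)`: first row
`(-𝔸_{p-1}(z)/𝔸_p(z), …, -𝔸_{-r}(z)/𝔸_p(z))`, ones on the subdiagonal, zeros elsewhere. -/
def Mmat (r p : ℕ) (a0 a1 : ℤ → ℂ) (z : ℂ) : Matrix (Fin (p + r)) (Fin (p + r)) ℂ :=
  fun i j =>
    if (i : ℕ) = 0 then - Acoef a0 a1 ((p : ℤ) - 1 - (j : ℕ)) z / Acoef a0 a1 (p : ℤ) z
    else if (i : ℕ) = (j : ℕ) + 1 then 1 else 0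

/-- the discrete Dirac mass `δ ∈ ℓ²(ℤ;ℂ)`. -/
def dirac : Seq2 := lp.single 2 (0 : ℤ) (1 : ℂ)

/-- The full set of data and assumptions (Assumptions 1–5) of the paper. -/
structure Setup where
  r : ℕ
  p : ℕ
  hrp : 1 ≤ p + r
  a0 : ℤ → ℂ
  a1 : ℤ → ℂ
  K : ℕ
  hK : 1 ≤ K
  /-- the tangency points `κ̲₁, …, κ̲_K` on the unit circle -/
  kap : Fin K → ℂ
  /-- the drifts `α_k` -/
  α : Fin K → ℝ
  /-- the diffusion coefficients `β_k` -/
  β : Fin K → ℝ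
  /-- the integers `μ_k` (the order of tangency is `2 μ_k`) -/
  μ : Fin K → ℕ
  /-- the operator `ℒ = Q₁⁻¹ Q₀` acting on `ℓ²(ℤ;ℂ)` -/
  L : Seq2 →L[ℂ] Seq2
  /-- Assumption 1: the symbol of `Q₁` does not vanish on the unit circle -/
  hQ1_ne : ∀ κ : ℂ, ‖κ‖ = 1 → symbol r p a1 κ ≠ 0
  /-- Assumption 1: the index condition -/
  hQ1_index :
    (2 * (Real.pi : ℂ) * Complex.I)⁻¹ *
      (∮ κ in C(0, 1), deriv (symbol r p a1) κ / symbol r p a1 κ) = 0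
  /-- `ℒ` is characterized by `Q₁ ∘ ℒ = Q₀` -/
  hL : ∀ (u : Seq2) (j : ℤ),
    convAct r p a1 (fun i => L u i) j = convAct r p a0 (fun i => u i) j
  /-- Assumption 2: the `κ̲_k` are distinct points of the unit circle -/
  hkap_unit : ∀ k, ‖kap k‖ = 1
  hkap_inj : Function.Injective kap
  /-- Assumption 2: `|F| < 1` away from the `κ̲_k` -/
  hF_lt : ∀ κ : ℂ, ‖κ‖ = 1 → (∀ k, κ ≠ kap k) → ‖Fsym r p a0 a1 κ‖ < 1
  /-- Assumption 2: `F(κ̲_k) ∈ 𝕊¹` -/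
  hF_unit : ∀ k, ‖Fsym r p a0 a1 (kap k)‖ = 1
  hα : ∀ k, α k ≠ 0
  hβ : ∀ k, 0 < β k
  hμ : ∀ k, 1 ≤ μ k
  /-- Assumption 2: local expansion
  `F(κ̲_k e^{iξ})/F(κ̲_k) = exp(-i α_k ξ - β_k ξ^{2μ_k} + O(ξ^{2μ_k+1}))` as `ξ → 0` -/
  hexp : ∀ k, ∃ g : ℝ → ℂ,
    (g =O[nhds 0] fun ξ : ℝ => ξ ^ (2 * μ k + 1)) ∧
    ∀ᶠ ξ : ℝ in nhds 0,
      Fsym r p a0 a1 (kap k * Complex.exp (Complex.I * ξ)) / Fsym r p a0 a1 (kap k)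
        = Complex.exp (-(Complex.I) * (α k : ℂ) * (ξ : ℂ)
            - (β k : ℂ) * (ξ : ℂ) ^ (2 * μ k) + g ξ)
  /-- Assumption 3: `𝔸_{-r}` and `𝔸_p` do not vanish on `𝒰̄` -/
  hA : ∀ z : ℂ, 1 ≤ ‖z‖ → Acoef a0 a1 (-(r : ℤ)) z ≠ 0 ∧ Acoef a0 a1 (p : ℤ) z ≠ 0
  /-- Assumption 4: either `Q₁` is the identity, or `a_{-r,1} ≠ 0` and `a_{p,1} ≠ 0` -/
  hQ1' : (∀ ℓ ∈ Finset.Icc (-(r : ℤ)) (p : ℤ), a1 ℓ = if ℓ = 0 then 1 else 0) ∨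
    (a1 (-(r : ℤ)) ≠ 0 ∧ a1 (p : ℤ) ≠ 0)
  /-- Assumption 5: each `ℐ_k` has one or two elements -/
  h5card : ∀ k : Fin K,
    (Finset.univ.filter fun ν =>
      Fsym r p a0 a1 (kap ν) = Fsym r p a0 a1 (kap k)).card ≤ 2
  /-- Assumption 5: when `ℐ_k` has two elements, the corresponding drifts have opposite signs -/
  h5sign : ∀ k ν₁ ν₂ : Fin K,
    Fsym r p a0 a1 (kap ν₁) = Fsym r p a0 a1 (kap k) →
    Fsym r p a0 a1 (kap ν₂) = Fsym r p a0 a1 (kap k) →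
    ν₁ ≠ ν₂ → α ν₁ * α ν₂ < 0

/-- the symbol `F` of `ℒ` -/
def Setup.F (S : Setup) : ℂ → ℂ := Fsym S.r S.p S.a0 S.a1

/-- the tangency points `z̲_k = F(κ̲_k)` of the spectrum of `ℒ` with the unit circle -/
def Setup.zK (S : Setup) (k : Fin S.K) : ℂ := S.F (S.kap k)

/-- the matrix `𝕄(z)` -/
def Setup.M (S : Setup) (z : ℂ) : Matrix (Fin (S.p + S.r)) (Fin (S.p + S.r)) ℂ :=
  Mmat S.r S.p S.a0 S.a1 z

lemma companion_charpoly_aux {n : ℕ} (f : Polynomial ℂ) (hf : f.Monic) (hn : f.natDegree = n)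
    (M : Matrix (Fin n) (Fin n) ℂ)
    (hM : ∀ i j : Fin n, M i j = if (i : ℕ) = 0 then -f.coeff (n - 1 - (j : ℕ))
      else if (i : ℕ) = (j : ℕ) + 1 then 1 else 0) : M.charpoly = f := by
  have hf0 : f ≠ 0 := hf.ne_zero
  obtain ⟨pb, hdim, hgen⟩ : ∃ pb : PowerBasis ℂ (AdjoinRoot f), pb.dim = n ∧
      minpoly ℂ pb.gen = f := by
    refine ⟨AdjoinRoot.powerBasis hf0, ?_, ?_⟩
    · simp [hn]
    · rw [AdjoinRoot.minpoly_powerBasis_gen hf0, hf.leadingCoeff]; simp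
  subst hdim
  have h1 := charpoly_leftMulMatrix pb
  rw [pb.leftMulMatrix, hgen] at h1
  refine Eq.trans ?_ h1
  rw [← Matrix.charpoly_transpose M, ← Matrix.charpoly_reindex Fin.revPerm]
  congr 1
  ext i j
  have hi := i.2
  have hj := j.2
  rw [PowerBasis.minpolyGen_eq, hgen]
  simp only [Matrix.reindex_apply, Matrix.submatrix_apply, Matrix.transpose_apply, Matrix.of_apply,
    hM, Fin.revPerm_symm, Fin.revPerm_apply, Fin.val_rev]
  have e1 : (pb.dim - ((j : ℕ) + 1) = 0) ↔ ((j : ℕ) + 1 = pb.dim) := by omega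
  have e2 : (pb.dim - ((j : ℕ) + 1) = pb.dim - ((i : ℕ) + 1) + 1) ↔ ((i : ℕ) = j + 1) := by omega
  have e3 : pb.dim - 1 - (pb.dim - ((i : ℕ) + 1)) = i := by omega
  simp only [e1, e2, e3]

/-- integral of the logarithmic derivative of a polynomial along the unit circle -/
lemma log_deriv_integral (A : Polynomial ℂ) (hA : ∀ z : ℂ, ‖z‖ = 1 → A.eval z ≠ 0) :
    (∮ z in C(0, 1), A.derivative.eval z / A.eval z) =
      2 * (Real.pi : ℂ) * Complex.I * ((A.roots.filter fun z => ‖z‖ < 1).card : ℂ) := by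
  have hA0 : A ≠ 0 := by
    rintro rfl; exact hA 1 (by simp) (by simp)
  have h1 : (∮ z in C(0, 1), A.derivative.eval z / A.eval z) =
      ∮ z in C(0, 1), (A.roots.map fun w => (z - w)⁻¹).sum := by
    apply circleIntegral.integral_congr zero_le_one
    intro z hz
    have hz' : ‖z‖ = 1 := by simpa using hz
    have := (IsAlgClosed.splits A).eval_derivative_div_eval_of_ne_zero (hA z hz')
    simpa [one_div] using this
  have hroots : ∀ w ∈ A.roots, ‖w‖ ≠ 1 := by
    intro w hw h
    exact hA w h (Polynomial.isRoot_of_mem_roots hw)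
  rw [h1]
  generalize A.roots = s at hroots
  have key : CircleIntegrable (fun z => (s.map fun w => (z - w)⁻¹).sum) 0 1 ∧
      (∮ z in C(0, 1), (s.map fun w => (z - w)⁻¹).sum) =
      2 * (Real.pi : ℂ) * Complex.I * ((s.filter fun z => ‖z‖ < 1).card : ℂ) := by
    induction s using Multiset.induction_on with
    | empty => simp [circleIntegral]
    | cons w s ih =>
      obtain ⟨ih1, ih2⟩ := ih (fun w hw => hroots w (Multiset.mem_cons_of_mem hw))
      have hw : ‖w‖ ≠ 1 := hroots w (Multiset.mem_cons_self _ _)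
      have hci : CircleIntegrable (fun z => (z - w)⁻¹) 0 1 := by
        apply ContinuousOn.circleIntegrable zero_le_one
        apply ContinuousOn.inv₀ (by fun_prop)
        intro z hz h
        have hz' : ‖z‖ = 1 := by simpa using hz
        rw [sub_eq_zero] at h
        exact hw (h ▸ hz')
      have hint : (∮ z in C(0, 1), (z - w)⁻¹) =
          2 * (Real.pi : ℂ) * Complex.I * (if ‖w‖ < 1 then 1 else 0) := by
        split_ifs with h
        · rw [circleIntegral.integral_sub_inv_of_mem_ball (by simpa using h), mul_one]
        · rw [mul_zero]
          apply Complex.circleIntegral_eq_zero_of_differentiable_on_off_countable zero_le_one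
            Set.countable_empty
          · apply ContinuousOn.inv₀ (by fun_prop)
            intro z hz h'
            have hz' : ‖z‖ ≤ 1 := by simpa using hz
            rw [sub_eq_zero] at h'
            subst h'
            exact hw (le_antisymm hz' (not_lt.1 h))
          · intro z hz
            have hz' : ‖z‖ < 1 := by simpa using hz.1
            apply DifferentiableAt.inv (by fun_prop)
            intro h'
            rw [sub_eq_zero] at h'
            subst h'
            exact h hz'
      simp only [Multiset.map_cons, Multiset.sum_cons]
      refine ⟨hci.add ih1, ?_⟩
      rw [circleIntegral.integral_add hci ih1, hint, ih2, Multiset.filter_cons]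
      split_ifs with h
      · simp; ring
      · simp
  exact key.2

lemma roots_card_eq_of_slit (A B : Polynomial ℂ) (hB : ∀ z : ℂ, ‖z‖ = 1 → B.eval z ≠ 0)
    (h : ∀ z : ℂ, ‖z‖ = 1 → A.eval z / B.eval z ∈ Complex.slitPlane) :
    (A.roots.filter fun z => ‖z‖ < 1).card = (B.roots.filter fun z => ‖z‖ < 1).card := by
  have hA : ∀ z : ℂ, ‖z‖ = 1 → A.eval z ≠ 0 := by
    intro z hz h0
    have := h z hz
    rw [h0, zero_div] at this
    simp at this
  have hcA : CircleIntegrable (fun z => A.derivative.eval z / A.eval z) 0 1 := by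
    apply ContinuousOn.circleIntegrable zero_le_one
    apply ContinuousOn.div (by fun_prop) (by fun_prop)
    intro z hz
    exact hA z (by simpa using hz)
  have hcB : CircleIntegrable (fun z => B.derivative.eval z / B.eval z) 0 1 := by
    apply ContinuousOn.circleIntegrable zero_le_one
    apply ContinuousOn.div (by fun_prop) (by fun_prop)
    intro z hz
    exact hB z (by simpa using hz)
  have h0 : (∮ z in C(0, 1), (A.derivative.eval z / A.eval z - B.derivative.eval z / B.eval z))
      = 0 := by
    apply circleIntegral.integral_eq_zero_of_hasDerivWithinAt zero_le_one
      (f := fun z => Complex.log (A.eval z / B.eval z))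
    intro z hz
    have hz' : ‖z‖ = 1 := by simpa using hz
    have hd := ((A.hasDerivAt z).div (B.hasDerivAt z) (hB z hz')).clog (h z hz')
    have := hA z hz'
    have := hB z hz'
    refine HasDerivAt.hasDerivWithinAt ?_
    refine hd.congr_deriv ?_
    simp only [Pi.div_apply]
    field_simp
  rw [circleIntegral.integral_sub hcA hcB, log_deriv_integral A hA, log_deriv_integral B hB,
    sub_eq_zero] at h0
  have := mul_left_cancel₀ Complex.two_pi_I_ne_zero h0
  exact_mod_cast this

/-- the polynomial `κ^r Q̂(κ)` -/
def qpoly (r p : ℕ) (a : ℤ → ℂ) : Polynomial ℂ :=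
  ∑ i ∈ Finset.range (p + r + 1), Polynomial.C (a ((i : ℤ) - r)) * Polynomial.X ^ i

lemma qpoly_coeff (r p : ℕ) (a : ℤ → ℂ) (i : ℕ) :
    (qpoly r p a).coeff i = if i < p + r + 1 then a ((i : ℤ) - r) else 0 := by
  simp [qpoly, Polynomial.coeff_C_mul, Polynomial.coeff_X_pow]

lemma qpoly_eval (r p : ℕ) (a : ℤ → ℂ) (κ : ℂ) (hκ : κ ≠ 0) :
    (qpoly r p a).eval κ = κ ^ r * symbol r p a κ := by
  rw [symbol, qpoly, Polynomial.eval_finsetSum, Finset.mul_sum]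
  refine Finset.sum_bij (fun i _ => (i : ℤ) - r) ?_ ?_ ?_ ?_
  · intro i hi
    simp only [Finset.mem_range] at hi
    simp only [Finset.mem_Icc]; omega
  · intro i _ j _ h; omega
  · intro l hl
    simp only [Finset.mem_Icc] at hl
    refine ⟨(l + r).toNat, ?_, ?_⟩
    · simp only [Finset.mem_range]; omega
    · omega
  · intro i _
    simp only [Polynomial.eval_mul, Polynomial.eval_C, Polynomial.eval_pow, Polynomial.eval_X]
    rw [zpow_sub₀ hκ, zpow_natCast, zpow_natCast]
    field_simp

lemma qpoly_Acoef (r p : ℕ) (a0 a1 : ℤ → ℂ) (z : ℂ) :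
    qpoly r p (fun l => Acoef a0 a1 l z) = Polynomial.C z * qpoly r p a1 - qpoly r p a0 := by
  ext i
  simp only [Polynomial.coeff_sub, Polynomial.coeff_C_mul, qpoly_coeff, Acoef]
  split_ifs <;> simp

lemma qpoly_natDegree (r p : ℕ) (a : ℤ → ℂ) (h : a p ≠ 0) : (qpoly r p a).natDegree = p + r := by
  apply Polynomial.natDegree_eq_of_le_of_coeff_ne_zero
  · rw [Polynomial.natDegree_le_iff_coeff_eq_zero]
    intro i hi
    rw [qpoly_coeff, if_neg (by omega)]
  · rw [qpoly_coeff, if_pos (by omega)]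
    simpa using h

lemma Mmat_charpoly (r p : ℕ) (a0 a1 : ℤ → ℂ) (z : ℂ) (h : Acoef a0 a1 (p : ℤ) z ≠ 0) :
    (Mmat r p a0 a1 z).charpoly =
      Polynomial.C (Acoef a0 a1 (p : ℤ) z)⁻¹ * qpoly r p (fun l => Acoef a0 a1 l z) := by
  have hd := qpoly_natDegree r p (fun l => Acoef a0 a1 l z) h
  apply companion_charpoly_aux
  · rw [Polynomial.Monic, Polynomial.leadingCoeff_mul, Polynomial.leadingCoeff_C,
      Polynomial.leadingCoeff, hd, qpoly_coeff, if_pos (by omega)]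
    simp [h]
  · rw [Polynomial.natDegree_C_mul (inv_ne_zero h), hd]
  · intro i j
    have hj := j.2
    rw [Mmat, Polynomial.coeff_C_mul, qpoly_coeff,
      if_pos (show p + r - 1 - (j : ℕ) < p + r + 1 by omega)]
    have : (((p + r - 1 - (j : ℕ) : ℕ) : ℤ) - r) = (p : ℤ) - 1 - (j : ℕ) := by omega
    rw [this]
    congr 1
    rw [neg_div, div_eq_inv_mul]

/-- index condition: `κ^r Q̂₁` has exactly `r` roots in the disc -/
lemma qpoly_index (r p : ℕ) (a : ℤ → ℂ) (hne : ∀ κ : ℂ, ‖κ‖ = 1 → symbol r p a κ ≠ 0)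
    (hidx : (2 * (Real.pi : ℂ) * Complex.I)⁻¹ *
      (∮ κ in C(0, 1), deriv (symbol r p a) κ / symbol r p a κ) = 0) :
    ((qpoly r p a).roots.filter fun z => ‖z‖ < 1).card = r := by
  have hn0 : ∀ z : ℂ, ‖z‖ = 1 → z ≠ 0 := by
    rintro z hz rfl; simp at hz
  have hA : ∀ z : ℂ, ‖z‖ = 1 → (qpoly r p a).eval z ≠ 0 := by
    intro z hz
    rw [qpoly_eval _ _ _ _ (hn0 z hz)]
    exact mul_ne_zero (pow_ne_zero _ (hn0 z hz)) (hne z hz)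
  have hX : ∀ z : ℂ, ‖z‖ = 1 → (Polynomial.X ^ r : Polynomial ℂ).eval z ≠ 0 := by
    intro z hz
    simpa using fun h => absurd h (hn0 z hz)
  have hcA : ∀ A : Polynomial ℂ, (∀ z : ℂ, ‖z‖ = 1 → A.eval z ≠ 0) →
      CircleIntegrable (fun z => A.derivative.eval z / A.eval z) 0 1 := by
    intro A hA
    apply ContinuousOn.circleIntegrable zero_le_one
    apply ContinuousOn.div (by fun_prop) (by fun_prop)
    intro z hz
    exact hA z (by simpa using hz)
  have h1 : (∮ κ in C(0, 1), deriv (symbol r p a) κ / symbol r p a κ) =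
      ∮ κ in C(0, 1), ((qpoly r p a).derivative.eval κ / (qpoly r p a).eval κ -
        (Polynomial.X ^ r : Polynomial ℂ).derivative.eval κ /
          (Polynomial.X ^ r : Polynomial ℂ).eval κ) := by
    apply circleIntegral.integral_congr zero_le_one
    intro z hz
    have hz' : ‖z‖ = 1 := by simpa using hz
    have hz0 := hn0 z hz'
    have hev : symbol r p a =ᶠ[nhds z] fun w => (qpoly r p a).eval w /
        (Polynomial.X ^ r : Polynomial ℂ).eval w := by
      filter_upwards [isOpen_ne.mem_nhds hz0] with w hw
      rw [qpoly_eval _ _ _ _ hw]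
      simp only [Polynomial.eval_pow, Polynomial.eval_X]
      have : w ≠ 0 := hw
      field_simp
    have hd := (((qpoly r p a).hasDerivAt z).div ((Polynomial.X ^ r : Polynomial ℂ).hasDerivAt z)
      (hX z hz')).congr_of_eventuallyEq hev
    have e1 := hA z hz'
    have e2 := hX z hz'
    simp only
    rw [hd.deriv, hev.eq_of_nhds]
    generalize (Polynomial.X ^ r : Polynomial ℂ) = T at *
    field_simp
  have h2 : (∮ κ in C(0, 1), deriv (symbol r p a) κ / symbol r p a κ) = 0 := by
    rcases mul_eq_zero.1 hidx with h | h
    · exact absurd h (inv_ne_zero Complex.two_pi_I_ne_zero)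
    · exact h
  rw [h1, circleIntegral.integral_sub (hcA _ hA) (hcA _ hX), log_deriv_integral _ hA,
    log_deriv_integral _ hX, sub_eq_zero] at h2
  have h3 := mul_left_cancel₀ Complex.two_pi_I_ne_zero h2
  have h4 : ((Polynomial.X ^ r : Polynomial ℂ).roots.filter fun z => ‖z‖ < 1).card = r := by
    rw [Polynomial.roots_pow, Polynomial.roots_X, Multiset.filter_eq_self.2]
    · simp
    · intro w hw
      have := Multiset.mem_of_mem_nsmul hw
      simp at this
      simp [this]
  rw [h4] at h3
  exact_mod_cast h3

lemma re_lt_one_aux {w : ℂ} (h : ‖w‖ ≤ 1) (h1 : w ≠ 1) : w.re < 1 := by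
  have h2 : w.re ^ 2 + w.im ^ 2 ≤ 1 := by
    have h3 : ‖w‖ ^ 2 ≤ 1 := by nlinarith [norm_nonneg w]
    rw [← Complex.normSq_eq_norm_sq, Complex.normSq_apply] at h3
    nlinarith
  by_contra h4
  push Not at h4
  have h5 : w.im = 0 := by nlinarith [sq_nonneg w.im]
  apply h1
  apply Complex.ext
  · simp; nlinarith [sq_nonneg w.im]
  · simpa using h5

lemma div_mem_slit {u v : ℂ} (hu : 0 < u.re) (hv : 0 < v.re) : u / v ∈ Complex.slitPlane := by
  have hv0 : v ≠ 0 := by rintro rfl; simp at hv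
  have h : u = (u / v) * v := by field_simp
  rw [Complex.mem_slitPlane_iff]
  by_contra h'
  push Not at h'
  obtain ⟨h1, h2⟩ := h'
  have h3 := congrArg Complex.re h
  rw [Complex.mul_re, h2] at h3
  nlinarith

lemma core_count (r p : ℕ) (q1 P : Polynomial ℂ) (z κ0 : ℂ) (α : ℝ)
    (hz : z ≠ 0) (hκ0 : ‖κ0‖ = 1)
    (hq1 : ∀ κ : ℂ, ‖κ‖ = 1 → q1.eval κ ≠ 0)
    (hcount : (q1.roots.filter fun κ => ‖κ‖ < 1).card = r)
    (hdeg : P.natDegree = p + r) (hP0 : P.eval κ0 = 0)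
    (hre : ∀ κ : ℂ, ‖κ‖ = 1 → κ ≠ κ0 → 0 < (P.eval κ / (z * q1.eval κ)).re)
    (hder : κ0 * P.derivative.eval κ0 = α * (z * q1.eval κ0)) (hα : α ≠ 0) :
    P.roots.count κ0 = 1 ∧
    (0 < α → (P.roots.filter fun κ => ‖κ‖ < 1).card + 1 = r ∧
      (P.roots.filter fun κ => 1 < ‖κ‖).card = p) ∧
    (α < 0 → (P.roots.filter fun κ => ‖κ‖ < 1).card = r ∧
      (P.roots.filter fun κ => 1 < ‖κ‖).card + 1 = p) := by
  have hκ00 : κ0 ≠ 0 := by rintro rfl; simp at hκ0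
  obtain ⟨R, hR⟩ := Polynomial.dvd_iff_isRoot.2 hP0
  have hRder : P.derivative.eval κ0 = R.eval κ0 := by
    rw [hR]; simp
  have hb : ∀ κ : ℂ, ‖κ‖ = 1 → z * q1.eval κ ≠ 0 := fun κ h => mul_ne_zero hz (hq1 κ h)
  have hR0 : R.eval κ0 ≠ 0 := by
    intro h
    rw [hRder, h, mul_zero] at hder
    exact mul_ne_zero (by exact_mod_cast hα) (hb κ0 hκ0) hder.symm
  have hRne : R ≠ 0 := by rintro rfl; simp at hR0
  have hPne : P ≠ 0 := by
    rw [hR]; exact mul_ne_zero (Polynomial.X_sub_C_ne_zero _) hRne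
  have hroots : P.roots = κ0 ::ₘ R.roots := by
    rw [hR, Polynomial.roots_mul (hR ▸ hPne), Polynomial.roots_X_sub_C, Multiset.singleton_add]
  have hPR : ∀ κ, P.eval κ = (κ - κ0) * R.eval κ := by intro κ; rw [hR]; simp
  have hRc : ∀ κ : ℂ, ‖κ‖ = 1 → R.eval κ ≠ 0 := by
    intro κ hκ
    by_cases h : κ = κ0
    · rwa [h]
    · intro h0
      have := hre κ hκ h
      rw [hPR, h0] at this
      simp at this
  have hB : ∀ κ : ℂ, ‖κ‖ = 1 → (Polynomial.C z * q1).eval κ ≠ 0 := by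
    intro κ h; simpa using hb κ h
  have hBr : ((Polynomial.C z * q1).roots.filter fun κ => ‖κ‖ < 1).card = r := by
    rw [Polynomial.roots_C_mul _ hz, hcount]
  have hcard : R.roots.card + 1 = p + r := by
    have h := (IsAlgClosed.splits P).natDegree_eq_card_roots
    rw [hroots, Multiset.card_cons, hdeg] at h
    exact h.symm
  have hsplit : (R.roots.filter fun κ => ‖κ‖ < 1).card + (R.roots.filter fun κ => 1 < ‖κ‖).card
      = R.roots.card := by
    rw [← Multiset.card_add]
    congr 1
    conv_rhs => rw [← Multiset.filter_add_not (fun κ : ℂ => ‖κ‖ < 1) R.roots]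
    congr 1
    apply Multiset.filter_congr
    intro w hw
    have : ‖w‖ ≠ 1 := fun h => hRc w h (Polynomial.isRoot_of_mem_roots hw)
    rw [not_lt]
    exact ⟨le_of_lt, fun h => lt_of_le_of_ne h (Ne.symm this)⟩
  have hin : (P.roots.filter fun κ => ‖κ‖ < 1) = R.roots.filter fun κ => ‖κ‖ < 1 := by
    rw [hroots, Multiset.filter_cons_of_neg]; simp [hκ0]
  have hout : (P.roots.filter fun κ => 1 < ‖κ‖) = R.roots.filter fun κ => 1 < ‖κ‖ := by
    rw [hroots, Multiset.filter_cons_of_neg]; simp [hκ0]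
  refine ⟨?_, ?_, ?_⟩
  · rw [hroots, Multiset.count_cons_self, Multiset.count_eq_zero_of_notMem]
    intro h
    exact hR0 (Polynomial.isRoot_of_mem_roots h)
  · intro hpos
    have key := roots_card_eq_of_slit (Polynomial.X * R) (Polynomial.C z * q1) hB (by
      intro κ hκ
      have hκn : κ ≠ 0 := by rintro rfl; simp at hκ
      have hbk := hb κ hκ
      simp only [Polynomial.eval_mul, Polynomial.eval_X, Polynomial.eval_C]
      by_cases h : κ = κ0
      · rw [h, ← hRder, hder, mul_div_cancel_right₀ _ (hb κ0 hκ0)]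
        exact Complex.ofReal_mem_slitPlane.2 hpos
      · have hs : κ - κ0 ≠ 0 := sub_ne_zero.2 h
        have h2 : 0 < (1 - κ0 / κ).re := by
          have := re_lt_one_aux (w := κ0 / κ) (by simp [hκ, hκ0]) (by
            intro h'; rw [div_eq_one_iff_eq hκn] at h'; exact h h'.symm)
          simpa using this
        have := div_mem_slit (hre κ hκ h) h2
        convert this using 1
        rw [hPR, one_sub_div hκn]
        generalize z * q1.eval κ = t at *
        field_simp)
    rw [hBr, Polynomial.roots_mul (mul_ne_zero Polynomial.X_ne_zero hRne), Polynomial.roots_X,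
      Multiset.singleton_add, Multiset.filter_cons_of_pos _ (by simp), Multiset.card_cons] at key
    rw [hin, hout]
    omega
  · intro hneg
    have key := roots_card_eq_of_slit (Polynomial.C (-κ0) * R) (Polynomial.C z * q1) hB (by
      intro κ hκ
      have hbk := hb κ hκ
      simp only [Polynomial.eval_mul, Polynomial.eval_C]
      by_cases h : κ = κ0
      · rw [h, ← hRder, neg_mul, hder, neg_div, mul_div_cancel_right₀ _ (hb κ0 hκ0)]
        rw [← Complex.ofReal_neg]
        exact Complex.ofReal_mem_slitPlane.2 (by linarith)
      · have hs : κ - κ0 ≠ 0 := sub_ne_zero.2 h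
        have hs' : κ0 - κ ≠ 0 := sub_ne_zero.2 (Ne.symm h)
        have h2 : 0 < (1 - κ / κ0).re := by
          have := re_lt_one_aux (w := κ / κ0) (by simp [hκ, hκ0]) (by
            intro h'; rw [div_eq_one_iff_eq hκ00] at h'; exact h h')
          simpa using this
        have := div_mem_slit (hre κ hκ h) h2
        convert this using 1
        rw [hPR, one_sub_div hκ00]
        generalize z * q1.eval κ = t at *
        field_simp
        ring)
    rw [hBr, Polynomial.roots_C_mul _ (neg_ne_zero.2 hκ00)] at key
    rw [hin, hout]
    omega

/-- derivative at `0` of the rescaled symbol along the circle -/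
lemma deriv_expansion (G : ℝ → ℂ) (α β : ℝ) (μ : ℕ) (hμ : 1 ≤ μ) (g : ℝ → ℂ)
    (hg : g =O[nhds 0] fun ξ : ℝ => ξ ^ (2 * μ + 1))
    (hG : ∀ᶠ ξ : ℝ in nhds 0, G ξ = Complex.exp (-(Complex.I) * (α : ℂ) * (ξ : ℂ)
            - (β : ℂ) * (ξ : ℂ) ^ (2 * μ) + g ξ)) :
    HasDerivAt G (-(Complex.I) * α) 0 := by
  have hg0 : g 0 = 0 := by
    have := hg.eq_zero_imp
    have h := this.self_of_nhds
    apply h; simp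
  have hgd : HasDerivAt g 0 0 := by
    rw [hasDerivAt_iff_isLittleO]
    simp only [hg0, sub_zero, smul_zero]
    refine hg.trans_isLittleO ?_
    have := isLittleO_pow_id (𝕜 := ℝ) (n := 2 * μ + 1) (by omega)
    simpa using this
  have hid : HasDerivAt (fun ξ : ℝ => (ξ : ℂ)) 1 0 := Complex.ofRealCLM.hasDerivAt
  have h1 := (((hid.const_mul (-(Complex.I) * (α : ℂ))).sub
    ((hid.pow (2 * μ)).const_mul (β : ℂ))).add hgd).cexp
  refine (h1.congr_of_eventuallyEq hG).congr_deriv ?_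
  have : 2 * μ - 1 ≠ 0 := by omega
  have h2 : μ ≠ 0 := by omega
  simp [hg0, this, h2]

/-- Lemma 1 (spectral splitting), cases I and II: if `ℐ_k = {k}` is a singleton, then `κ̲_k` is an
algebraically simple eigenvalue of `𝕄(z̲_k)`; besides it, `𝕄(z̲_k)` has `r-1` eigenvalues in `𝔻`
and `p` eigenvalues in `𝒰` when `α_k > 0`, and `r` eigenvalues in `𝔻` and `p-1` eigenvalues in
`𝒰` when `α_k < 0` (counted with algebraic multiplicity). -/
theorem spectral_splitting_tangency_singleton (S : Setup) (k : Fin S.K)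
    (hsing : ∀ ν, S.zK ν = S.zK k → ν = k) :
    Polynomial.rootMultiplicity (S.kap k) (S.M (S.zK k)).charpoly = 1 ∧
    (0 < S.α k →
      ((S.M (S.zK k)).charpoly.roots.filter fun κ => ‖κ‖ < 1).card = S.r - 1 ∧
      ((S.M (S.zK k)).charpoly.roots.filter fun κ => 1 < ‖κ‖).card = S.p) ∧
    (S.α k < 0 →
      ((S.M (S.zK k)).charpoly.roots.filter fun κ => ‖κ‖ < 1).card = S.r ∧
      ((S.M (S.zK k)).charpoly.roots.filter fun κ => 1 < ‖κ‖).card = S.p - 1) := by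
  have hF1 : ∀ κ : ℂ, ‖κ‖ = 1 → ‖S.F κ‖ ≤ 1 := by
    intro κ hκ
    by_cases h : ∀ ν, κ ≠ S.kap ν
    · exact (S.hF_lt κ hκ h).le
    · push Not at h
      obtain ⟨ν, rfl⟩ := h
      exact (S.hF_unit ν).le
  have hz1 : ‖S.zK k‖ = 1 := S.hF_unit k
  have hz0 : S.zK k ≠ 0 := by intro h; rw [h] at hz1; simp at hz1
  have hFne : ∀ κ : ℂ, ‖κ‖ = 1 → κ ≠ S.kap k → S.F κ ≠ S.zK k := by
    intro κ hκ hne h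
    by_cases h' : ∀ ν, κ ≠ S.kap ν
    · have := S.hF_lt κ hκ h'
      rw [← hz1, ← h] at this
      exact lt_irrefl _ this
    · push Not at h'
      obtain ⟨ν, rfl⟩ := h'
      exact hne (by rw [hsing ν h])
  have hA := (S.hA (S.zK k) hz1.ge).2
  have hn0 : ∀ z : ℂ, ‖z‖ = 1 → z ≠ 0 := by
    rintro z hz rfl; simp at hz
  have hq1 : ∀ κ : ℂ, ‖κ‖ = 1 → (qpoly S.r S.p S.a1).eval κ ≠ 0 := by
    intro κ hκ
    rw [qpoly_eval _ _ _ _ (hn0 κ hκ)]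
    exact mul_ne_zero (pow_ne_zero _ (hn0 κ hκ)) (S.hQ1_ne κ hκ)
  have hPe : ∀ κ : ℂ, ‖κ‖ = 1 →
      (qpoly S.r S.p (fun l => Acoef S.a0 S.a1 l (S.zK k))).eval κ =
        S.zK k * (qpoly S.r S.p S.a1).eval κ * (1 - S.F κ / S.zK k) := by
    intro κ hκ
    rw [qpoly_Acoef]
    simp only [Polynomial.eval_sub, Polynomial.eval_mul, Polynomial.eval_C]
    rw [qpoly_eval _ _ _ _ (hn0 κ hκ), qpoly_eval _ _ _ _ (hn0 κ hκ), Setup.F, Fsym]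
    have := S.hQ1_ne κ hκ
    field_simp
  have hk := S.hkap_unit k
  obtain ⟨g, hg, hG⟩ := S.hexp k
  have hGd := deriv_expansion (fun ξ : ℝ => S.F (S.kap k * Complex.exp (Complex.I * ξ)) / S.zK k)
    (S.α k) (S.β k) (S.μ k) (S.hμ k) g hg hG
  have hcirc : HasDerivAt (fun ξ : ℝ => S.kap k * Complex.exp (Complex.I * ξ))
      (S.kap k * Complex.I) 0 := by
    have hid : HasDerivAt (fun ξ : ℝ => (ξ : ℂ)) 1 0 := Complex.ofRealCLM.hasDerivAt
    have := ((hid.const_mul Complex.I).cexp).const_mul (S.kap k)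
    simpa using this
  have hcn : ∀ ξ : ℝ, ‖S.kap k * Complex.exp (Complex.I * ξ)‖ = 1 := by
    intro ξ
    rw [norm_mul, hk, mul_comm Complex.I, Complex.norm_exp_ofReal_mul_I, one_mul]
  have hc0 : S.kap k * Complex.exp (Complex.I * (0 : ℝ)) = S.kap k := by simp
  have hpolyd : ∀ A : Polynomial ℂ, HasDerivAt
      (fun ξ : ℝ => A.eval (S.kap k * Complex.exp (Complex.I * ξ)))
      (A.derivative.eval (S.kap k) * (S.kap k * Complex.I)) 0 := by
    intro A
    have h1 := A.hasDerivAt (S.kap k * Complex.exp (Complex.I * (0 : ℝ)))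
    have h2 := HasDerivAt.comp (0 : ℝ) h1 hcirc
    rw [hc0] at h2
    exact h2
  have hder : S.kap k *
      (qpoly S.r S.p (fun l => Acoef S.a0 S.a1 l (S.zK k))).derivative.eval (S.kap k) =
      (S.α k : ℂ) * (S.zK k * (qpoly S.r S.p S.a1).eval (S.kap k)) := by
    have h1 := hpolyd (qpoly S.r S.p (fun l => Acoef S.a0 S.a1 l (S.zK k)))
    have h2 := ((hpolyd (qpoly S.r S.p S.a1)).const_mul (S.zK k)).mul (hGd.const_sub 1)
    have h3 : (fun ξ : ℝ => (qpoly S.r S.p (fun l => Acoef S.a0 S.a1 l (S.zK k))).eval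
        (S.kap k * Complex.exp (Complex.I * ξ))) = _ := funext fun ξ => hPe _ (hcn ξ)
    rw [h3] at h1
    have h4 := h1.unique h2
    have h5 : S.F (S.kap k) / S.zK k = 1 := div_self hz0
    simp only [hc0, h5, sub_self, mul_zero, zero_add] at h4
    have hI := Complex.I_ne_zero
    apply mul_right_cancel₀ hI
    linear_combination h4
  have core := core_count S.r S.p (qpoly S.r S.p S.a1)
    (qpoly S.r S.p (fun l => Acoef S.a0 S.a1 l (S.zK k))) (S.zK k) (S.kap k) (S.α k) hz0 hk hq1
    (qpoly_index S.r S.p S.a1 S.hQ1_ne S.hQ1_index)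
    (qpoly_natDegree S.r S.p _ hA)
    (by
      rw [hPe _ hk]
      have h5 : S.F (S.kap k) / S.zK k = 1 := div_self hz0
      rw [h5, sub_self, mul_zero])
    (by
      intro κ hκ hne
      rw [hPe κ hκ, mul_div_cancel_left₀ _ (mul_ne_zero hz0 (hq1 κ hκ))]
      have := re_lt_one_aux (w := S.F κ / S.zK k)
        (by rw [norm_div, hz1, div_one]; exact hF1 κ hκ)
        (by
          intro h
          rw [div_eq_one_iff_eq hz0] at h
          exact hFne κ hκ hne h)
      simpa using this)
    hder (S.hα k)
  have hroots : (S.M (S.zK k)).charpoly.roots =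
      (qpoly S.r S.p (fun l => Acoef S.a0 S.a1 l (S.zK k))).roots := by
    rw [Setup.M, Mmat_charpoly _ _ _ _ _ hA, Polynomial.roots_C_mul _ (inv_ne_zero hA)]
  rw [← Polynomial.count_roots, hroots]
  obtain ⟨c1, c2, c3⟩ := core
  refine ⟨by convert c1, fun h => ?_, fun h => ?_⟩
  · obtain ⟨d1, d2⟩ := c2 h
    constructor
    · exact Nat.eq_sub_of_add_eq d1
    · exact d2
  · obtain ⟨d1, d2⟩ := c3 h
    constructor
    · exact d1
    · exact Nat.eq_sub_of_add_eq d2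
end
end

section
/- Under Assumptions 1–5, let k ∈ {1, …, K} be such that ℐ_k = {ν₁, ν₂} has two elements. Then κ̲_{ν₁} and κ̲_{ν₂} are algebraically simple eigenvalues of 𝕄(z̲_k), and besides these two eigenvalues, 𝕄(z̲_k) has exactly r − 1 eigenvalues in 𝔻 and exactly p − 1 eigenvalues in 𝒰 (counted with algebraic multiplicity). -/
open scoped Classical
open Complex Filter Asymptotics Metric

noncomputable section

set_option autoImplicit false

/-- number of roots in the open unit disc -/
def nin (f : Polynomial ℂ) : ℕ := (f.roots.filter fun κ => ‖κ‖ < 1).card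

lemma integral_inv_one (w : ℂ) (hw : ‖w‖ ≠ 1) :
    CircleIntegrable (fun z => 1 / (z - w)) 0 1 ∧
    (∮ z in C(0, 1), 1 / (z - w)) = 2 * (Real.pi : ℂ) * Complex.I * (if ‖w‖ < 1 then 1 else 0) := by
  constructor
  · apply ContinuousOn.circleIntegrable zero_le_one
    apply ContinuousOn.div continuousOn_const (by fun_prop)
    intro z hz h
    have : z = w := by linear_combination h
    subst this
    simp at hz
    exact hw hz
  · split_ifs with h
    · simp only [one_div, mul_one]
      exact circleIntegral.integral_sub_inv_of_mem_ball (by simpa using h)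
    · rw [mul_zero]
      have hlt : 1 < ‖w‖ := lt_of_le_of_ne (not_lt.mp h) (Ne.symm hw)
      have hne : ∀ z ∈ closedBall (0 : ℂ) 1, z - w ≠ 0 := by
        intro z hz h
        have : z = w := by linear_combination h
        subst this
        simp at hz
        linarith
      apply circleIntegral_eq_zero_of_differentiable_on_off_countable zero_le_one
        (Set.countable_empty)
      · exact ContinuousOn.div continuousOn_const (by fun_prop) hne
      · intro z hz
        have := hne z (ball_subset_closedBall hz.1)
        fun_prop (disch := assumption)

lemma integral_multiset (s : Multiset ℂ) (hs : ∀ w ∈ s, ‖w‖ ≠ 1) :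
    CircleIntegrable (fun z => (s.map fun w => 1 / (z - w)).sum) 0 1 ∧
    (∮ z in C(0, 1), (s.map fun w => 1 / (z - w)).sum) =
      2 * (Real.pi : ℂ) * Complex.I * ((s.filter fun κ => ‖κ‖ < 1).card : ℂ) := by
  induction s using Multiset.induction_on with
  | empty => simp [circleIntegral]
  | cons a s ih =>
    obtain ⟨h1, h2⟩ := ih (fun w hw => hs w (Multiset.mem_cons_of_mem hw))
    obtain ⟨h3, h4⟩ := integral_inv_one a (hs a (Multiset.mem_cons_self a s))
    simp only [Multiset.map_cons, Multiset.sum_cons]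
    refine ⟨h3.add h1, ?_⟩
    rw [circleIntegral.integral_add h3 h1, h2, h4, Multiset.filter_cons]
    split_ifs <;> simp <;> ring

lemma integral_logderiv (f : Polynomial ℂ) (hf : ∀ z : ℂ, ‖z‖ = 1 → f.eval z ≠ 0) :
    CircleIntegrable (fun z => f.derivative.eval z / f.eval z) 0 1 ∧
    (∮ z in C(0, 1), f.derivative.eval z / f.eval z) =
      2 * (Real.pi : ℂ) * Complex.I * (nin f : ℂ) := by
  constructor
  · apply ContinuousOn.circleIntegrable zero_le_one
    apply ContinuousOn.div (by fun_prop) (by fun_prop)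
    intro z hz
    exact hf z (by simpa using hz)
  · have := (integral_multiset f.roots ?_).2
    · rw [nin, ← this]
      apply circleIntegral.integral_congr zero_le_one
      intro z hz
      exact (IsAlgClosed.splits f).eval_derivative_div_eval_of_ne_zero (hf z (by simpa using hz))
    · intro w hw h
      exact hf w h (Polynomial.isRoot_of_mem_roots hw)

lemma two_pi_I_ne : 2 * (Real.pi : ℂ) * Complex.I ≠ 0 := by
  simp [Real.pi_ne_zero]

/-- Rouché for polynomials on the unit circle. -/
lemma rouche (f g : Polynomial ℂ)
    (h : ∀ z : ℂ, ‖z‖ = 1 → ‖f.eval z - g.eval z‖ < ‖g.eval z‖) : nin f = nin g := by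
  have hg : ∀ z : ℂ, ‖z‖ = 1 → g.eval z ≠ 0 := by
    intro z hz h0
    have := h z hz
    rw [h0, norm_zero] at this
    exact absurd this (not_lt.mpr (norm_nonneg _))
  have hf : ∀ z : ℂ, ‖z‖ = 1 → f.eval z ≠ 0 := by
    intro z hz h0
    have := h z hz
    rw [h0, zero_sub, norm_neg] at this
    exact lt_irrefl _ this
  obtain ⟨i1, e1⟩ := integral_logderiv f hf
  obtain ⟨i2, e2⟩ := integral_logderiv g hg
  have key : (∮ z in C(0, 1), (f.derivative.eval z / f.eval z - g.derivative.eval z / g.eval z))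
      = 0 := by
    apply circleIntegral.integral_eq_zero_of_hasDerivWithinAt
      (f := fun z => Complex.log (f.eval z / g.eval z)) zero_le_one
    intro z hz
    have hz' : ‖z‖ = 1 := by simpa using hz
    have hfz := hf z hz'
    have hgz := hg z hz'
    have hsl : f.eval z / g.eval z ∈ Complex.slitPlane := by
      left
      have h1 : ‖f.eval z / g.eval z - 1‖ < 1 := by
        rw [div_sub_one hgz, norm_div, div_lt_one (norm_pos_iff.mpr hgz)]
        exact h z hz'
      have h2 := (Complex.abs_re_le_norm (f.eval z / g.eval z - 1)).trans_lt h1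
      rw [abs_lt] at h2
      simp only [Complex.sub_re, Complex.one_re] at h2
      linarith [h2.1]
    have hd := ((f.hasDerivAt z).div (g.hasDerivAt z) hgz).clog hsl
    have he : f.derivative.eval z / f.eval z - g.derivative.eval z / g.eval z =
        (f.derivative.eval z * g.eval z - f.eval z * g.derivative.eval z) / g.eval z ^ 2 /
          (f.eval z / g.eval z) := by
      field_simp
    rw [he]
    exact hd.hasDerivWithinAt
  rw [circleIntegral.integral_sub i1 i2, e1, e2, ← mul_sub] at key
  have := (mul_eq_zero.mp key).resolve_left two_pi_I_ne
  exact_mod_cast sub_eq_zero.mp this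

lemma companion_charpoly (n : ℕ) (f : Polynomial ℂ) (hm : f.Monic) (hd : f.natDegree = n)
    (M : Matrix (Fin n) (Fin n) ℂ)
    (hM : ∀ i j, M i j = if (i : ℕ) = 0 then - f.coeff (n - 1 - j)
      else if (i : ℕ) = (j : ℕ) + 1 then 1 else 0) : M.charpoly = f := by
  let pb := AdjoinRoot.powerBasis hm.ne_zero
  have hdim : pb.dim = n := by rw [← hd]; exact AdjoinRoot.powerBasis_dim hm.ne_zero
  have hmin : minpoly ℂ pb.gen = f := AdjoinRoot.minpoly_powerBasis_gen_of_monic hm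
  have hc := charpoly_leftMulMatrix pb
  rw [hmin] at hc
  rw [← hc, ← Matrix.charpoly_transpose,
    ← Matrix.charpoly_reindex ((finCongr hdim).trans Fin.revPerm)]
  congr 1
  ext i j
  rw [Matrix.transpose_apply, hM, PowerBasis.leftMulMatrix]
  simp only [Matrix.reindex_apply, Matrix.submatrix_apply, Matrix.of_apply, PowerBasis.minpolyGen_eq, hmin]
  simp only [finCongr_symm, Equiv.symm_trans_apply, Fin.revPerm_symm, Fin.revPerm_apply,
    finCongr_apply, Fin.val_cast, Fin.val_rev, hdim]
  have hi := i.isLt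
  have hj := j.isLt
  have e1 : (n - ((j : ℕ) + 1) + 1 = n) ↔ ((j : ℕ) = 0) := by omega
  have e2 : (n - ((i : ℕ) + 1) = n - ((j : ℕ) + 1) + 1) ↔ ((j : ℕ) = i + 1) := by omega
  simp only [e1, e2, Nat.sub_sub, Nat.add_comm 1]

open Polynomial in
lemma perturb (r : ℕ) (G W : Polynomial ℂ) (κ₁ κ₂ : ℂ) (n1 : ‖κ₁‖ = 1) (n2 : ‖κ₂‖ = 1)
    (hne : κ₁ ≠ κ₂) (γ₁ γ₂ : ℝ) (g1 : 0 < γ₁) (g2 : 0 < γ₂)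
    (hG : ∀ z : ℂ, ‖z‖ = 1 → G.eval z ≠ 0)
    (h1 : W.eval κ₁ = κ₁ * γ₁ * (κ₁ - κ₂) * G.eval κ₁)
    (h2 : W.eval κ₂ = -κ₂ * γ₂ * (κ₂ - κ₁) * G.eval κ₂)
    (hr : ∀ δ : ℝ, 0 < δ → nin ((X - C κ₁) * (X - C κ₂) * G + C (δ : ℂ) * W) = r) :
    nin G + 1 = r := by
  have hG0 : G ≠ 0 := by
    rintro rfl
    exact hG κ₁ n1 (by simp)
  -- the first-order remainder
  set E : Polynomial ℂ := W - (C (κ₁ * γ₁) * (X - C κ₂) + C (-κ₂ * γ₂) * (X - C κ₁)) * G with hE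
  have hE1 : (X - C κ₁) ∣ E := by
    rw [dvd_iff_isRoot, IsRoot, hE]
    simp [h1]
  have hE2 : (X - C κ₂) ∣ E := by
    rw [dvd_iff_isRoot, IsRoot, hE]
    simp [h2]
  obtain ⟨H, hH⟩ : (X - C κ₁) * (X - C κ₂) ∣ E :=
    (isCoprime_X_sub_C_of_isUnit_sub (sub_ne_zero.mpr hne).isUnit).mul_dvd hE1 hE2
  -- compactness bounds
  have hcpt : IsCompact (sphere (0 : ℂ) 1) := isCompact_sphere 0 1
  obtain ⟨CH, hCH⟩ := hcpt.exists_bound_of_continuousOn (f := fun z => H.eval z)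
    (by fun_prop)
  obtain ⟨z0, hz0, hmin⟩ := hcpt.exists_isMinOn ⟨κ₁, by simpa using n1⟩
    (f := fun z => ‖G.eval z‖) (by fun_prop)
  set c := ‖G.eval z0‖ with hc
  have hcpos : 0 < c := norm_pos_iff.mpr (hG z0 (by simpa using hz0))
  have hCH0 : 0 ≤ CH := (norm_nonneg _).trans (hCH κ₁ (by simpa using n1))
  set D := ‖κ₁ - κ₂‖ with hD
  have hDpos : 0 < D := norm_pos_iff.mpr (sub_ne_zero.mpr hne)
  set T := 4 * CH / c + 4 / D * (γ₁ + γ₂) with hT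
  have hT0 : 0 ≤ T := by positivity
  obtain ⟨δ, hδ, hδT, hδ1⟩ : ∃ δ : ℝ, 0 < δ ∧ δ * T < 1 ∧ δ * γ₁ < 1 := by
    refine ⟨1 / (T + γ₁ + 1), by positivity, ?_, ?_⟩
    · rw [div_mul_eq_mul_div, div_lt_one (by positivity)]; linarith
    · rw [div_mul_eq_mul_div, div_lt_one (by positivity)]; linarith
  set w₁ : ℂ := κ₁ * ((1 - δ * γ₁ : ℝ) : ℂ) with hw1
  set w₂ : ℂ := κ₂ * ((1 + δ * γ₂ : ℝ) : ℂ) with hw2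
  have nw1 : ‖w₁‖ = 1 - δ * γ₁ := by
    rw [hw1, norm_mul, n1, one_mul, Complex.norm_real, Real.norm_of_nonneg (by linarith)]
  have nw2 : ‖w₂‖ = 1 + δ * γ₂ := by
    rw [hw2, norm_mul, n2, one_mul, Complex.norm_real, Real.norm_of_nonneg (by positivity)]
  have d1 : ‖w₁ - κ₁‖ = δ * γ₁ := by
    have : w₁ - κ₁ = -(κ₁ * ((δ * γ₁ : ℝ) : ℂ)) := by rw [hw1]; push_cast; ring
    rw [this, norm_neg, norm_mul, n1, one_mul, Complex.norm_real,
      Real.norm_of_nonneg (by positivity)]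
  have d2 : ‖w₂ - κ₂‖ = δ * γ₂ := by
    have : w₂ - κ₂ = (κ₂ * ((δ * γ₂ : ℝ) : ℂ)) := by rw [hw2]; push_cast; ring
    rw [this, norm_mul, n2, one_mul, Complex.norm_real,
      Real.norm_of_nonneg (by positivity)]
  have hnin : nin ((X - C w₁) * ((X - C w₂) * G)) = nin G + 1 := by
    have hp : 0 < δ * γ₁ := by positivity
    have hp2 : 0 < δ * γ₂ := by positivity
    unfold nin
    rw [roots_mul (mul_ne_zero (X_sub_C_ne_zero _) (mul_ne_zero (X_sub_C_ne_zero _) hG0)),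
      roots_mul (mul_ne_zero (X_sub_C_ne_zero _) hG0), roots_X_sub_C, roots_X_sub_C,
      Multiset.filter_add, Multiset.filter_add, Multiset.filter_singleton,
      Multiset.filter_singleton, if_pos (by rw [nw1]; linarith),
      if_neg (by rw [nw2]; linarith)]
    simp [add_comm]
  rw [← hr δ hδ, ← hnin]
  symm
  apply rouche
  intro x hx
  have hxs : x ∈ sphere (0 : ℂ) 1 := by simpa using hx
  have hGx : c ≤ ‖G.eval x‖ := hmin hxs
  have hHx := hCH x hxs
  have hWx : W.eval x = (x - κ₁) * (x - κ₂) * H.eval x +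
      (κ₁ * γ₁ * (x - κ₂) + (-κ₂ * γ₂) * (x - κ₁)) * G.eval x := by
    have := congrArg (eval x) hH
    rw [hE] at this
    simp at this
    linear_combination this
  have hdiff : eval x ((X - C κ₁) * (X - C κ₂) * G + C (δ : ℂ) * W) -
      eval x ((X - C w₁) * ((X - C w₂) * G)) =
      δ * ((x - κ₁) * (x - κ₂) * H.eval x) - ((w₁ - κ₁) * (w₂ - κ₂)) * G.eval x := by
    simp only [eval_add, eval_mul, eval_sub, eval_X, eval_C, hWx, hw1, hw2]
    push_cast
    ring
  rw [hdiff]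
  simp only [eval_mul, eval_sub, eval_X, eval_C]
  rw [norm_mul, norm_mul]
  set m₁ := ‖x - w₁‖ with hm1
  set m₂ := ‖x - w₂‖ with hm2
  have b1 : δ * γ₁ ≤ m₁ := by
    have := norm_sub_norm_le x w₁
    rw [hx, nw1] at this
    linarith
  have b2 : δ * γ₂ ≤ m₂ := by
    have := norm_sub_norm_le w₂ x
    rw [hx, nw2, norm_sub_rev] at this
    linarith
  have hp1 : 0 < δ * γ₁ := by positivity
  have hp2 : 0 < δ * γ₂ := by positivity
  have e1 : ‖x - κ₁‖ ≤ 2 * m₁ := by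
    have := norm_sub_le_norm_sub_add_norm_sub x w₁ κ₁
    linarith
  have e2 : ‖x - κ₂‖ ≤ 2 * m₂ := by
    have := norm_sub_le_norm_sub_add_norm_sub x w₂ κ₂
    linarith
  have e3 : D ≤ 2 * m₁ + 2 * m₂ := by
    have := norm_sub_le_norm_sub_add_norm_sub κ₁ x κ₂
    rw [norm_sub_rev κ₁ x] at this
    linarith
  have hm1p : 0 < m₁ := by linarith
  have hm2p : 0 < m₂ := by linarith
  have f1 : (δ * γ₁) * (δ * γ₂) ≤ δ * (4 / D * (γ₁ + γ₂)) * (m₁ * m₂) := by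
    have : D * ((δ * γ₁) * (δ * γ₂)) ≤ 4 * (δ * (γ₁ + γ₂)) * (m₁ * m₂) := by
      rcases le_total m₁ m₂ with h | h
      · have hDm : D ≤ 4 * m₂ := by linarith
        calc D * ((δ * γ₁) * (δ * γ₂)) ≤ (4 * m₂) * (m₁ * (δ * γ₂)) := by gcongr
          _ = 4 * (δ * γ₂) * (m₁ * m₂) := by ring
          _ ≤ _ := by gcongr; linarith
      · have hDm : D ≤ 4 * m₁ := by linarith
        calc D * ((δ * γ₁) * (δ * γ₂)) ≤ (4 * m₁) * ((δ * γ₁) * m₂) := by gcongr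
          _ = 4 * (δ * γ₁) * (m₁ * m₂) := by ring
          _ ≤ _ := by gcongr; linarith
    have h3 : δ * (4 / D * (γ₁ + γ₂)) * (m₁ * m₂) = (4 * (δ * (γ₁ + γ₂)) * (m₁ * m₂)) / D := by
      ring
    rw [h3, le_div_iff₀ hDpos]
    linarith
  have hGp : 0 < ‖G.eval x‖ := lt_of_lt_of_le hcpos hGx
  calc ‖δ * ((x - κ₁) * (x - κ₂) * H.eval x) - ((w₁ - κ₁) * (w₂ - κ₂)) * G.eval x‖
      ≤ ‖(δ : ℂ) * ((x - κ₁) * (x - κ₂) * H.eval x)‖ + ‖((w₁ - κ₁) * (w₂ - κ₂)) * G.eval x‖ :=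
        norm_sub_le _ _
    _ = δ * (‖x - κ₁‖ * ‖x - κ₂‖ * ‖H.eval x‖) + (δ * γ₁) * (δ * γ₂) * ‖G.eval x‖ := by
        rw [norm_mul, norm_mul, norm_mul, norm_mul, norm_mul, d1, d2, Complex.norm_real,
          Real.norm_of_nonneg hδ.le]
    _ ≤ δ * ((2 * m₁) * (2 * m₂) * (CH / c * ‖G.eval x‖)) +
        δ * (4 / D * (γ₁ + γ₂)) * (m₁ * m₂) * ‖G.eval x‖ := by
        have : ‖H.eval x‖ ≤ CH / c * ‖G.eval x‖ := by
          refine hHx.trans ?_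
          rw [div_mul_eq_mul_div, le_div_iff₀ hcpos]
          gcongr
        gcongr
    _ = (δ * T) * (m₁ * m₂ * ‖G.eval x‖) := by rw [hT]; ring
    _ < 1 * (m₁ * m₂ * ‖G.eval x‖) := by
        apply mul_lt_mul_of_pos_right hδT; positivity
    _ = _ := by ring

/-- the polynomial `κ^r Q̂(κ)` -/
def symPoly (r p : ℕ) (a : ℤ → ℂ) : Polynomial ℂ :=
  ∑ i ∈ Finset.range (p + r + 1), Polynomial.C (a ((i : ℤ) - r)) * Polynomial.X ^ i

lemma symPoly_coeff (r p : ℕ) (a : ℤ → ℂ) (i : ℕ) :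
    (symPoly r p a).coeff i = if i < p + r + 1 then a ((i : ℤ) - r) else 0 := by
  simp [symPoly, Polynomial.coeff_C_mul, Polynomial.coeff_X_pow]

lemma symPoly_eval (r p : ℕ) (a : ℤ → ℂ) (κ : ℂ) (hκ : κ ≠ 0) :
    (symPoly r p a).eval κ = κ ^ r * symbol r p a κ := by
  rw [symPoly, symbol, Polynomial.eval_finsetSum, Finset.mul_sum]
  refine Finset.sum_bij' (fun i _ => (i : ℤ) - r) (fun ℓ _ => (ℓ + r).toNat) ?_ ?_ ?_ ?_ ?_
  · intro i hi
    simp only [Finset.mem_range, Finset.mem_Icc] at *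
    omega
  · intro i hi
    simp only [Finset.mem_range, Finset.mem_Icc] at *
    omega
  · intro i hi
    simp
  · intro i hi
    simp only [Finset.mem_Icc] at *
    omega
  · intro i hi
    rw [zpow_sub₀ hκ]
    simp only [Polynomial.eval_mul, Polynomial.eval_C, Polynomial.eval_pow, Polynomial.eval_X,
      zpow_natCast]
    field_simp

lemma symPoly_A (r p : ℕ) (a0 a1 : ℤ → ℂ) (z : ℂ) :
    symPoly r p (fun ℓ => Acoef a0 a1 ℓ z) =
      Polynomial.C z * symPoly r p a1 - symPoly r p a0 := by
  ext i
  rw [Polynomial.coeff_sub, Polynomial.coeff_C_mul, symPoly_coeff, symPoly_coeff, symPoly_coeff]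
  split_ifs <;> simp [Acoef]

lemma symPoly_natDegree (r p : ℕ) (a : ℤ → ℂ) (ha : a p ≠ 0) :
    (symPoly r p a).natDegree = p + r := by
  apply Polynomial.natDegree_eq_of_le_of_coeff_ne_zero
  · rw [Polynomial.natDegree_le_iff_coeff_eq_zero]
    intro N hN
    rw [symPoly_coeff, if_neg (by omega)]
  · rw [symPoly_coeff, if_pos (by omega)]
    simpa using ha

lemma charpoly_Mmat (r p : ℕ) (a0 a1 : ℤ → ℂ) (z : ℂ) (hA : Acoef a0 a1 p z ≠ 0) :
    (Mmat r p a0 a1 z).charpoly = Polynomial.C (Acoef a0 a1 p z)⁻¹ *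
      symPoly r p (fun ℓ => Acoef a0 a1 ℓ z) := by
  have hdeg := symPoly_natDegree r p (fun ℓ => Acoef a0 a1 ℓ z) hA
  apply companion_charpoly
  · rw [Polynomial.Monic, Polynomial.leadingCoeff, Polynomial.natDegree_C_mul (inv_ne_zero hA),
      hdeg, Polynomial.coeff_C_mul, symPoly_coeff, if_pos (by omega)]
    simp [hA]
  · rw [Polynomial.natDegree_C_mul (inv_ne_zero hA), hdeg]
  · intro i j
    have hj := j.isLt
    rw [Polynomial.coeff_C_mul, symPoly_coeff,
      if_pos (show p + r - 1 - (j : ℕ) < p + r + 1 by omega), Mmat]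
    have : ((p + r - 1 - (j : ℕ) : ℕ) : ℤ) - r = (p : ℤ) - 1 - (j : ℕ) := by omega
    rw [this]
    split_ifs <;> ring

lemma nin_symPoly (r p : ℕ) (a : ℤ → ℂ) (hne : ∀ κ : ℂ, ‖κ‖ = 1 → symbol r p a κ ≠ 0)
    (hidx : (2 * (Real.pi : ℂ) * Complex.I)⁻¹ *
      (∮ κ in C(0, 1), deriv (symbol r p a) κ / symbol r p a κ) = 0) :
    nin (symPoly r p a) = r := by
  have hn0 : ∀ κ : ℂ, ‖κ‖ = 1 → κ ≠ 0 := by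
    rintro κ h rfl
    simp at h
  have hR : ∀ κ : ℂ, ‖κ‖ = 1 → (symPoly r p a).eval κ ≠ 0 := by
    intro κ h
    rw [symPoly_eval r p a κ (hn0 κ h)]
    exact mul_ne_zero (pow_ne_zero _ (hn0 κ h)) (hne κ h)
  obtain ⟨i1, e1⟩ := integral_logderiv _ hR
  obtain ⟨i2, e2⟩ := integral_inv_one 0 (by simp)
  have h0 := (mul_eq_zero.mp hidx).resolve_left (inv_ne_zero two_pi_I_ne)
  have i3 : CircleIntegrable (fun z : ℂ => (r : ℂ) * (1 / (z - 0))) 0 1 := i2.const_fun_smul (a := (r : ℂ))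
  have key : (∮ κ in C(0, 1), deriv (symbol r p a) κ / symbol r p a κ) =
      ∮ κ in C(0, 1), ((symPoly r p a).derivative.eval κ / (symPoly r p a).eval κ -
        (r : ℂ) * (1 / (κ - 0))) := by
    apply circleIntegral.integral_congr zero_le_one
    intro κ hκ
    have hκ1 : ‖κ‖ = 1 := by simpa using hκ
    have hκ0 := hn0 κ hκ1
    have hev : symbol r p a =ᶠ[nhds κ] fun x => (symPoly r p a).eval x / x ^ r := by
      filter_upwards [isOpen_ne.mem_nhds hκ0] with x hx
      rw [symPoly_eval r p a x hx]
      field_simp [show x ≠ 0 from hx]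
    have hd : HasDerivAt (fun x => (symPoly r p a).eval x / x ^ r) _ κ :=
      ((symPoly r p a).hasDerivAt κ).div (hasDerivAt_pow r κ) (pow_ne_zero _ hκ0)
    have hs := hne κ hκ1
    beta_reduce
    rw [hev.deriv_eq, hd.deriv, symPoly_eval r p a κ hκ0]
    rcases r with _ | r
    · simp
    · simp only [Nat.add_sub_cancel]
      push_cast
      rw [sub_zero]
      field_simp
      ring
  rw [key, circleIntegral.integral_sub i1 i3, e1, circleIntegral.integral_const_mul, e2] at h0
  simp only [norm_zero, zero_lt_one, if_true] at h0
  have h1 : (2 * (Real.pi : ℂ) * Complex.I) * ((nin (symPoly r p a) : ℂ) - r) = 0 := by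
    linear_combination h0
  have := (mul_eq_zero.mp h1).resolve_left two_pi_I_ne
  exact_mod_cast sub_eq_zero.mp this

/-- the derivative information at a tangency point -/
lemma deriv_at_tangency (S : Setup) (k : Fin S.K) :
    (Polynomial.C (S.zK k) * symPoly S.r S.p S.a1 - symPoly S.r S.p S.a0).derivative.eval
      (S.kap k) * S.kap k = S.zK k * (symPoly S.r S.p S.a1).eval (S.kap k) * S.α k := by
  obtain ⟨g, hg, hev⟩ := S.hexp k
  set κ := S.kap k with hκ
  set R := symPoly S.r S.p S.a1 with hR
  set P := Polynomial.C (S.zK k) * R - symPoly S.r S.p S.a0 with hP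
  have hz0 : S.zK k ≠ 0 := by
    intro h
    have := S.hF_unit k
    rw [show Fsym S.r S.p S.a0 S.a1 (S.kap k) = 0 from h] at this
    simp at this
  have hgd : HasDerivAt g 0 0 := by
    have h1 : g =O[nhds (0 : ℝ)] fun ξ : ℝ => ‖ξ - 0‖ ^ (2 * S.μ k + 1) := by
      refine hg.trans (IsBigO.of_bound 1 (Filter.Eventually.of_forall fun x => ?_))
      simp
    have := h1.hasFDerivAt (𝕜 := ℝ) (by have := S.hμ k; omega)
    simpa using this.hasDerivAt
  have hg0 : g 0 = 0 := by
    have := hg.eq_zero_imp.self_of_nhds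
    exact this (by simp)
  have hid : HasDerivAt (fun ξ : ℝ => (ξ : ℂ)) 1 0 := Complex.ofRealCLM.hasDerivAt
  have hpath : HasDerivAt (fun ξ : ℝ => κ * Complex.exp (Complex.I * ξ)) (κ * Complex.I) 0 := by
    have := ((hid.const_mul Complex.I).cexp).const_mul κ
    simpa using this
  have hφ : HasDerivAt (fun ξ : ℝ => Complex.exp (-(Complex.I) * (S.α k : ℂ) * (ξ : ℂ)
            - (S.β k : ℂ) * (ξ : ℂ) ^ (2 * S.μ k) + g ξ)) (-(Complex.I) * (S.α k : ℂ)) 0 := by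
    have hμ := S.hμ k
    have h := (((hid.const_mul (-(Complex.I) * (S.α k : ℂ))).sub
      ((hid.pow (2 * S.μ k)).const_mul (S.β k : ℂ))).add hgd).cexp
    have e1 : (2 * S.μ k) ≠ 0 := by omega
    have e2 : (2 * S.μ k - 1) ≠ 0 := by omega
    simpa [hg0, e1, e2] using h
  have hpe : ∀ f : Polynomial ℂ, HasDerivAt (fun ξ : ℝ => f.eval (κ * Complex.exp (Complex.I * ξ)))
      (f.derivative.eval κ * (κ * Complex.I)) 0 := by
    intro f
    have h := f.hasDerivAt (κ * Complex.exp (Complex.I * (0 : ℝ)))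
    have h0 := HasDerivAt.comp (0 : ℝ) h hpath
    have h' : HasDerivAt (fun ξ : ℝ => f.eval (κ * Complex.exp (Complex.I * ξ)))
      (f.derivative.eval (κ * Complex.exp (Complex.I * (0 : ℝ))) * (κ * Complex.I)) 0 :=
      h0
    simpa using h'
  have hRHS := ((hpe R).const_mul (S.zK k)).mul (hφ.const_sub 1)
  have heq : (fun ξ : ℝ => P.eval (κ * Complex.exp (Complex.I * ξ))) =ᶠ[nhds 0]
      fun ξ : ℝ => (S.zK k * R.eval (κ * Complex.exp (Complex.I * ξ))) *
        (1 - Complex.exp (-(Complex.I) * (S.α k : ℂ) * (ξ : ℂ)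
            - (S.β k : ℂ) * (ξ : ℂ) ^ (2 * S.μ k) + g ξ)) := by
    filter_upwards [hev] with ξ hξ
    rw [← hξ]
    have hn : ‖κ * Complex.exp (Complex.I * ξ)‖ = 1 := by
      rw [norm_mul, hκ, S.hkap_unit k, mul_comm Complex.I, Complex.norm_exp_ofReal_mul_I, one_mul]
    have hx0 : κ * Complex.exp (Complex.I * ξ) ≠ 0 := by
      intro h
      rw [h] at hn
      simp at hn
    set x := κ * Complex.exp (Complex.I * ξ) with hx
    have hs := S.hQ1_ne x hn
    rw [hP, Polynomial.eval_sub, Polynomial.eval_mul, Polynomial.eval_C, hR,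
      symPoly_eval _ _ _ _ hx0, symPoly_eval _ _ _ _ hx0]
    change _ = _ * (1 - Fsym S.r S.p S.a0 S.a1 x / S.zK k)
    rw [Fsym]
    field_simp
  have hu := (hpe P).unique (hRHS.congr_of_eventuallyEq heq)
  simp only [Complex.ofReal_zero, mul_zero, zero_mul, Complex.exp_zero, mul_one, hg0, add_zero,
    sub_zero] at hu
  have e1 : (2 * S.μ k) ≠ 0 := by have := S.hμ k; omega
  simp [e1] at hu
  have hI := Complex.I_ne_zero
  apply mul_right_cancel₀ hI
  linear_combination hu

open Polynomial in
/-- the main count, when `α_{ν₁} > 0 > α_{ν₂}` -/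
lemma main_aux (S : Setup) (k ν₁ ν₂ : Fin S.K) (hne : ν₁ ≠ ν₂)
    (h₁ : S.zK ν₁ = S.zK k) (h₂ : S.zK ν₂ = S.zK k)
    (hpair : ∀ ν, S.zK ν = S.zK k → ν = ν₁ ∨ ν = ν₂)
    (ha1 : 0 < S.α ν₁) (ha2 : S.α ν₂ < 0) :
    Polynomial.rootMultiplicity (S.kap ν₁) (S.M (S.zK k)).charpoly = 1 ∧
    Polynomial.rootMultiplicity (S.kap ν₂) (S.M (S.zK k)).charpoly = 1 ∧
    ((S.M (S.zK k)).charpoly.roots.filter fun κ => ‖κ‖ < 1).card = S.r - 1 ∧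
    ((S.M (S.zK k)).charpoly.roots.filter fun κ => 1 < ‖κ‖).card = S.p - 1 := by
  have d1 := deriv_at_tangency S ν₁
  have d2 := deriv_at_tangency S ν₂
  rw [h₁] at d1
  rw [h₂] at d2
  have hz1 : ‖S.zK k‖ = 1 := S.hF_unit k
  set z := S.zK k with hz
  have hz0 : z ≠ 0 := by
    intro h
    rw [h] at hz1
    simp at hz1
  have hAp := (S.hA z hz1.ge).2
  have hchar : (S.M z).charpoly = C (Acoef S.a0 S.a1 S.p z)⁻¹ *
      (C z * symPoly S.r S.p S.a1 - symPoly S.r S.p S.a0) := by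
    rw [← symPoly_A]
    exact charpoly_Mmat _ _ _ _ _ hAp
  have hdeg : (C z * symPoly S.r S.p S.a1 - symPoly S.r S.p S.a0).natDegree = S.p + S.r := by
    rw [← symPoly_A]
    exact symPoly_natDegree _ _ _ hAp
  set R := symPoly S.r S.p S.a1 with hR
  set Q := symPoly S.r S.p S.a0 with hQ
  have hn0 : ∀ κ : ℂ, ‖κ‖ = 1 → κ ≠ 0 := by
    rintro κ h rfl
    simp at h
  have hR0 : ∀ κ : ℂ, ‖κ‖ = 1 → R.eval κ ≠ 0 := by
    intro κ h
    rw [hR, symPoly_eval _ _ _ κ (hn0 κ h)]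
    exact mul_ne_zero (pow_ne_zero _ (hn0 κ h)) (S.hQ1_ne κ h)
  have hQF : ∀ κ : ℂ, ‖κ‖ = 1 → Q.eval κ = S.F κ * R.eval κ := by
    intro κ h
    have := S.hQ1_ne κ h
    rw [hR, hQ, symPoly_eval _ _ _ κ (hn0 κ h), symPoly_eval _ _ _ κ (hn0 κ h), Setup.F, Fsym]
    field_simp
  have hF1 : ∀ κ : ℂ, ‖κ‖ = 1 → ‖S.F κ‖ ≤ 1 := by
    intro κ h
    by_cases hk : ∃ ν, κ = S.kap ν
    · obtain ⟨ν, rfl⟩ := hk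
      exact (S.hF_unit ν).le
    · push Not at hk
      exact (S.hF_lt κ h hk).le
  have hPF : ∀ κ : ℂ, ‖κ‖ = 1 → (C z * R - Q).eval κ = (z - S.F κ) * R.eval κ := by
    intro κ h
    rw [eval_sub, eval_mul, eval_C, hQF κ h]
    ring
  set κ₁ := S.kap ν₁ with hκ1
  set κ₂ := S.kap ν₂ with hκ2
  have n1 : ‖κ₁‖ = 1 := S.hkap_unit ν₁
  have n2 : ‖κ₂‖ = 1 := S.hkap_unit ν₂
  have hκne : κ₁ ≠ κ₂ := fun h => hne (S.hkap_inj h)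
  have r1 : (C z * R - Q).eval κ₁ = 0 := by
    rw [hPF κ₁ n1, show S.F κ₁ = z from h₁]; ring
  have r2 : (C z * R - Q).eval κ₂ = 0 := by
    rw [hPF κ₂ n2, show S.F κ₂ = z from h₂]; ring
  have hroots : ∀ κ : ℂ, ‖κ‖ = 1 → (C z * R - Q).eval κ = 0 → κ = κ₁ ∨ κ = κ₂ := by
    intro κ h h0
    rw [hPF κ h] at h0
    have hF := (mul_eq_zero.mp h0).resolve_right (hR0 κ h)
    by_cases hk : ∃ ν, κ = S.kap ν
    · obtain ⟨ν, rfl⟩ := hk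
      rcases hpair ν (sub_eq_zero.mp hF).symm with rfl | rfl
      · left; rfl
      · right; rfl
    · push Not at hk
      have h3 : ‖S.F κ‖ < 1 := S.hF_lt κ h hk
      rw [← sub_eq_zero.mp hF, hz1] at h3
      exact absurd h3 (lt_irrefl _)
  obtain ⟨G, hG⟩ : (X - C κ₁) * (X - C κ₂) ∣ (C z * R - Q) :=
    (isCoprime_X_sub_C_of_isUnit_sub (sub_ne_zero.mpr hκne).isUnit).mul_dvd
      (dvd_iff_isRoot.mpr r1) (dvd_iff_isRoot.mpr r2)
  have D1 : (C z * R - Q).derivative.eval κ₁ = (κ₁ - κ₂) * G.eval κ₁ := by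
    rw [hG]; simp
  have D2 : (C z * R - Q).derivative.eval κ₂ = (κ₂ - κ₁) * G.eval κ₂ := by
    rw [hG]; simp
  rw [D1] at d1
  rw [D2] at d2
  have ha1c : (S.α ν₁ : ℂ) ≠ 0 := by exact_mod_cast ha1.ne'
  have ha2c : (S.α ν₂ : ℂ) ≠ 0 := by exact_mod_cast ha2.ne
  have hG1 : G.eval κ₁ ≠ 0 := by
    intro h
    rw [h, mul_zero, zero_mul] at d1
    exact mul_ne_zero (mul_ne_zero hz0 (hR0 κ₁ n1)) ha1c d1.symm
  have hG2 : G.eval κ₂ ≠ 0 := by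
    intro h
    rw [h, mul_zero, zero_mul] at d2
    exact mul_ne_zero (mul_ne_zero hz0 (hR0 κ₂ n2)) ha2c d2.symm
  have hGc : ∀ κ : ℂ, ‖κ‖ = 1 → G.eval κ ≠ 0 := by
    intro κ h h0
    have : (C z * R - Q).eval κ = 0 := by rw [hG]; simp [h0]
    rcases hroots κ h this with rfl | rfl
    · exact hG1 h0
    · exact hG2 h0
  have hG0 : G ≠ 0 := by
    rintro rfl
    simp at hG1
  have hninR : nin R = S.r := nin_symPoly _ _ _ S.hQ1_ne S.hQ1_index
  have hcount : nin G + 1 = S.r := by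
    apply perturb S.r G (C z * R) κ₁ κ₂ n1 n2 hκne (1 / S.α ν₁) (-1 / S.α ν₂)
      (by positivity) (div_pos_of_neg_of_neg (by norm_num) ha2) hGc
    · rw [eval_mul, eval_C]
      push_cast
      field_simp
      linear_combination -d1
    · rw [eval_mul, eval_C]
      push_cast
      field_simp
      linear_combination -d2
    · intro δ hδ
      rw [← hG, ← hninR]
      have hd1 : (1 + (δ : ℂ)) ≠ 0 := by
        have : (0 : ℝ) < 1 + δ := by linarith
        exact_mod_cast this.ne'
      have hsame : nin (C ((1 + (δ : ℂ)) * z) * R) = nin R := by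
        unfold nin
        rw [roots_C_mul _ (mul_ne_zero hd1 hz0)]
      rw [← hsame]
      apply rouche
      intro x hx
      have e1 : eval x (C z * R - Q + C (δ : ℂ) * (C z * R)) -
          eval x (C ((1 + (δ : ℂ)) * z) * R) = -(S.F x * R.eval x) := by
        simp only [eval_add, eval_sub, eval_mul, eval_C, hQF x hx]
        ring
      have e2 : ‖(1 + (δ : ℂ))‖ = 1 + δ := by
        have : (1 + (δ : ℂ)) = ((1 + δ : ℝ) : ℂ) := by push_cast; rfl
        rw [this, Complex.norm_real, Real.norm_of_nonneg (by linarith)]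
      rw [e1, norm_neg, eval_mul, eval_C, norm_mul, norm_mul, norm_mul, e2, hz1, mul_one]
      apply mul_lt_mul_of_pos_right _ (norm_pos_iff.mpr (hR0 x hx))
      linarith [hF1 x hx]
  have hrootsP : (S.M z).charpoly.roots = {κ₁} + {κ₂} + G.roots := by
    rw [hchar, roots_C_mul _ (inv_ne_zero hAp), hG,
      roots_mul (mul_ne_zero (mul_ne_zero (X_sub_C_ne_zero _) (X_sub_C_ne_zero _)) hG0),
      roots_mul (mul_ne_zero (X_sub_C_ne_zero _) (X_sub_C_ne_zero _)), roots_X_sub_C,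
      roots_X_sub_C]
  have c1 : G.roots.count κ₁ = 0 := by
    rw [Multiset.count_eq_zero]
    exact fun h => hG1 (isRoot_of_mem_roots h)
  have c2 : G.roots.count κ₂ = 0 := by
    rw [Multiset.count_eq_zero]
    exact fun h => hG2 (isRoot_of_mem_roots h)
  have hGdeg : G.roots.card + 2 = S.p + S.r := by
    have hcard : (S.M z).charpoly.roots.card = S.p + S.r := by
      rw [hchar, roots_C_mul _ (inv_ne_zero hAp), ← hdeg]
      exact (IsAlgClosed.splits _).natDegree_eq_card_roots.symm
    rw [hrootsP] at hcard
    simp at hcard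
    omega
  have hsplit : nin G + (G.roots.filter fun κ => 1 < ‖κ‖).card = G.roots.card := by
    have h3 := congrArg Multiset.card (Multiset.filter_add_not (fun κ : ℂ => ‖κ‖ < 1) G.roots)
    rw [Multiset.card_add] at h3
    rw [← h3, nin]
    congr 2
    apply Multiset.filter_congr
    intro x hx
    have : ‖x‖ ≠ 1 := fun h => hGc x h (isRoot_of_mem_roots hx)
    rw [not_lt]
    exact ⟨le_of_lt, fun h => lt_of_le_of_ne h this.symm⟩
  refine ⟨?_, ?_, ?_, ?_⟩
  · rw [← count_roots, hrootsP, Multiset.count_add, Multiset.count_add, c1]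
    simp [Multiset.count_singleton, hκne]
  · rw [← count_roots, hrootsP, Multiset.count_add, Multiset.count_add, c2]
    simp [Multiset.count_singleton, hκne.symm]
  · rw [hrootsP, Multiset.filter_add, Multiset.filter_add, Multiset.filter_singleton,
      Multiset.filter_singleton, if_neg (by rw [n1]; exact lt_irrefl _),
      if_neg (by rw [n2]; exact lt_irrefl _)]
    simp only [Multiset.card_add, Multiset.empty_eq_zero, Multiset.card_zero, zero_add]
    change nin G = _
    omega
  · rw [hrootsP, Multiset.filter_add, Multiset.filter_add, Multiset.filter_singleton,
      Multiset.filter_singleton, if_neg (by rw [n1]; exact lt_irrefl _),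
      if_neg (by rw [n2]; exact lt_irrefl _)]
    simp only [Multiset.card_add, Multiset.empty_eq_zero, Multiset.card_zero, zero_add]
    omega

/-- Lemma 1 (spectral splitting), case III: if `ℐ_k = {ν₁, ν₂}` has two elements, then `κ̲_{ν₁}`
and `κ̲_{ν₂}` are algebraically simple eigenvalues of `𝕄(z̲_k)`, and besides them `𝕄(z̲_k)` has
exactly `r-1` eigenvalues in `𝔻` and `p-1` eigenvalues in `𝒰` (with algebraic multiplicity). -/
theorem spectral_splitting_tangency_pair (S : Setup) (k ν₁ ν₂ : Fin S.K) (hne : ν₁ ≠ ν₂)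
    (h₁ : S.zK ν₁ = S.zK k) (h₂ : S.zK ν₂ = S.zK k)
    (hpair : ∀ ν, S.zK ν = S.zK k → ν = ν₁ ∨ ν = ν₂) :
    Polynomial.rootMultiplicity (S.kap ν₁) (S.M (S.zK k)).charpoly = 1 ∧
    Polynomial.rootMultiplicity (S.kap ν₂) (S.M (S.zK k)).charpoly = 1 ∧
    ((S.M (S.zK k)).charpoly.roots.filter fun κ => ‖κ‖ < 1).card = S.r - 1 ∧
    ((S.M (S.zK k)).charpoly.roots.filter fun κ => 1 < ‖κ‖).card = S.p - 1 := by
  have hs := S.h5sign k ν₁ ν₂ h₁ h₂ hne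
  rcases lt_or_gt_of_ne (S.hα ν₁) with h | h
  · have h' : 0 < S.α ν₂ := by
      by_contra hc
      nlinarith [mul_nonneg_of_nonpos_of_nonpos h.le (not_lt.mp hc)]
    obtain ⟨q1, q2, q3, q4⟩ := main_aux S k ν₂ ν₁ hne.symm h₂ h₁
      (fun ν hν => (hpair ν hν).symm) h' h
    exact ⟨q2, q1, q3, q4⟩
  · have h' : S.α ν₂ < 0 := by
      by_contra hc
      nlinarith [mul_nonneg h.le (not_lt.mp hc)]
    exact main_aux S k ν₁ ν₂ hne h₁ h₂ hpair h h'
end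
end

section
/- Under Assumptions 1–5, let k ∈ {1, …, K} be such that ℐ_k = {k} is a singleton. Then there exist ε > 0 and a holomorphic function κ_k : B_ε(z̲_k) → ℂ such that κ_k(z̲_k) = κ̲_k, for every z ∈ B_ε(z̲_k) the number κ_k(z) is an algebraically simple eigenvalue of 𝕄(z) and F(κ_k(z)) = z, and the Taylor expansion κ_k(z̲_k (1 + ε′))/κ̲_k = 1 − ε′/α_k + O(ε′²) holds as real ε′ → 0; in particular, if α_k > 0 then κ_k(z̲_k (1 + ε′)) ∈ 𝔻 for all sufficiently small ε′ > 0, while if α_k < 0 then κ_k(z̲_k (1 + ε′)) ∈ 𝒰 for all sufficiently small ε′ > 0. -/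
open scoped Classical
open Complex Filter Asymptotics Metric

noncomputable section

set_option autoImplicit false

/-- determinant of a companion-type matrix -/
theorem comp_det (n : ℕ) (x : ℂ) (b : ℕ → ℂ) :
    (Matrix.of fun i j : Fin n => (if i = j then x else 0) +
      (if (i : ℕ) = 0 then b j else if (i : ℕ) = (j : ℕ) + 1 then -1 else 0)).det
      = x ^ n + ∑ j ∈ Finset.range n, b j * x ^ (n - 1 - j) := by
  induction n with
  | zero => simp
  | succ n ih =>
    rw [Matrix.det_succ_column _ (Fin.last n)]
    have hsplit : ∀ i : Fin (n + 1),
        (Matrix.of fun i j : Fin (n + 1) => (if i = j then x else 0) +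
          (if (i : ℕ) = 0 then b j else if (i : ℕ) = (j : ℕ) + 1 then -1 else 0)) i (Fin.last n)
        = (if i = Fin.last n then x else 0) + (if i = 0 then b n else 0) := by
      intro i
      have h1 : (i : ℕ) ≠ n + 1 := by have := i.2; omega
      simp [h1]
    simp only [hsplit, mul_add, add_mul, Finset.sum_add_distrib]
    have hA : ∀ g : Fin (n + 1) → ℂ, ∀ h : Fin (n + 1) → ℂ, ∀ c : ℂ, ∀ a : Fin (n + 1),
        ∑ i, g i * (if i = a then c else 0) * h i = g a * c * h a := by
      intro g h c a
      rw [Finset.sum_eq_single a]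
      · simp
      · intro i _ hi; simp [hi]
      · simp
    rw [hA, hA]
    have hm1 : ((Matrix.of fun i j : Fin (n + 1) => (if i = j then x else 0) +
          (if (i : ℕ) = 0 then b j else if (i : ℕ) = (j : ℕ) + 1 then -1 else 0)).submatrix
          (Fin.last n).succAbove (Fin.last n).succAbove) =
        (Matrix.of fun i j : Fin n => (if i = j then x else 0) +
          (if (i : ℕ) = 0 then b j else if (i : ℕ) = (j : ℕ) + 1 then -1 else 0)) := by
      ext i j
      simp only [Matrix.submatrix_apply, Matrix.of_apply, Fin.succAbove_last, Fin.val_castSucc,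
        Fin.castSucc_inj]
    have hm2 : ((Matrix.of fun i j : Fin (n + 1) => (if i = j then x else 0) +
          (if (i : ℕ) = 0 then b j else if (i : ℕ) = (j : ℕ) + 1 then -1 else 0)).submatrix
          (0 : Fin (n + 1)).succAbove (Fin.last n).succAbove).det = (-1) ^ n := by
      rw [Matrix.det_of_isUpperTriangular]
      · simp only [Matrix.submatrix_apply, Matrix.of_apply, Fin.succAbove_last, Fin.val_castSucc,
          Fin.zero_succAbove, Fin.val_succ, Fin.ext_iff]
        simp
      · intro i j hij
        have hij' : (j : ℕ) < i := hij
        have h1 : ¬ ((i : ℕ) + 1 = j) := by omega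
        have h2 : ¬ ((i : ℕ) = j) := by omega
        simp only [Matrix.submatrix_apply, Matrix.of_apply, Fin.succAbove_last, Fin.val_castSucc,
          Fin.zero_succAbove, Fin.val_succ, Fin.ext_iff]
        simp [h1, h2]
    rw [hm1, hm2, ih, Finset.sum_range_succ]
    have hs : ∑ j ∈ Finset.range n, b j * x ^ (n + 1 - 1 - j)
        = x * ∑ j ∈ Finset.range n, b j * x ^ (n - 1 - j) := by
      rw [Finset.mul_sum]
      refine Finset.sum_congr rfl fun j hj => ?_
      have hj' := Finset.mem_range.1 hj
      have : n + 1 - 1 - j = (n - 1 - j) + 1 := by omega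
      rw [this, pow_succ]; ring
    rw [hs]
    have e1 : ((-1 : ℂ)) ^ ((Fin.last n : ℕ) + (Fin.last n : ℕ)) = 1 := by
      rw [← two_mul, pow_mul]; simp
    have e2 : ((-1 : ℂ)) ^ (((0 : Fin (n + 1)) : ℕ) + (Fin.last n : ℕ)) * b n * (-1) ^ n = b n := by
      have : ((-1 : ℂ)) ^ n * (-1) ^ n = 1 := by rw [← mul_pow]; simp
      simp only [Fin.val_zero, Fin.val_last, zero_add]
      linear_combination b n * this
    rw [e1, e2]
    simp
    ring

theorem charpoly_eval (r p : ℕ) (a0 a1 : ℤ → ℂ) (z κ : ℂ) (hκ : κ ≠ 0)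
    (hA : Acoef a0 a1 (p : ℤ) z ≠ 0) :
    (Mmat r p a0 a1 z).charpoly.eval κ =
      κ ^ r * (z * symbol r p a1 κ - symbol r p a0 κ) / Acoef a0 a1 (p : ℤ) z := by
  rw [Matrix.eval_charpoly]
  have hm : Matrix.scalar (Fin (p + r)) κ - Mmat r p a0 a1 z =
      (Matrix.of fun i j : Fin (p + r) => (if i = j then κ else 0) +
      (if (i : ℕ) = 0 then (fun j : ℕ => Acoef a0 a1 ((p : ℤ) - 1 - j) z / Acoef a0 a1 (p : ℤ) z) j
        else if (i : ℕ) = (j : ℕ) + 1 then -1 else 0)) := by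
    ext i j
    simp only [Matrix.sub_apply, Matrix.scalar_apply, Matrix.diagonal_apply, Mmat, Matrix.of_apply,
      sub_eq_add_neg]
    congr 1
    split_ifs <;> ring
  refine (congrArg Matrix.det hm).trans ((comp_det (p + r) κ
    (fun j : ℕ => Acoef a0 a1 ((p : ℤ) - 1 - j) z / Acoef a0 a1 (p : ℤ) z)).trans ?_)
  rw [eq_div_iff hA]
  have hsum : z * symbol r p a1 κ - symbol r p a0 κ =
      ∑ ℓ ∈ Finset.Icc (-(r : ℤ)) (p : ℤ), Acoef a0 a1 ℓ z * κ ^ ℓ := by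
    simp only [symbol, Acoef, Finset.mul_sum, sub_mul, Finset.sum_sub_distrib, mul_assoc]
  have hre : ∑ ℓ ∈ Finset.Icc (-(r : ℤ)) (p : ℤ), Acoef a0 a1 ℓ z * κ ^ ℓ =
      ∑ m ∈ Finset.range (p + r + 1), Acoef a0 a1 ((p : ℤ) - m) z * κ ^ ((p : ℤ) - m) := by
    symm
    refine Finset.sum_bij (fun m _ => (p : ℤ) - m) ?_ ?_ ?_ ?_
    · intro m hm; simp only [Finset.mem_range, Finset.mem_Icc] at *; omega
    · intro m _ m' _ h; simpa using h
    · intro ℓ hℓ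
      simp only [Finset.mem_Icc] at hℓ
      exact ⟨((p : ℤ) - ℓ).toNat, by simp only [Finset.mem_range]; omega, by omega⟩
    · intro m _; rfl
  rw [hsum, hre, Finset.sum_range_succ', mul_add, Finset.mul_sum, add_mul, Finset.sum_mul, add_comm]
  congr 1
  · refine Finset.sum_congr rfl fun m hm => ?_
    have hm' := Finset.mem_range.1 hm
    have e : κ ^ r * κ ^ ((p : ℤ) - (m + 1 : ℕ)) = κ ^ (p + r - 1 - m) := by
      rw [← zpow_natCast, ← zpow_natCast, ← zpow_add₀ hκ]
      congr 1; omega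
    rw [← e]
    push_cast
    rw [show (p : ℤ) - (m + 1) = p - 1 - m by ring]
    field_simp
  · have e : κ ^ r * κ ^ ((p : ℤ) - (0 : ℕ)) = κ ^ (p + r) := by
      rw [← zpow_natCast, ← zpow_natCast, ← zpow_add₀ hκ]
      congr 1; omega
    rw [← e]; simp; ring

theorem symbol_analyticAt (r p : ℕ) (a : ℤ → ℂ) (κ : ℂ) (hκ : κ ≠ 0) :
    AnalyticAt ℂ (symbol r p a) κ := by
  unfold symbol
  refine Finset.analyticAt_fun_sum _ fun ℓ _ => ?_
  exact analyticAt_const.mul (analyticAt_id.zpow hκ)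

theorem Fsym_analyticAt (r p : ℕ) (a0 a1 : ℤ → ℂ) (κ : ℂ) (hκ : κ ≠ 0)
    (h1 : symbol r p a1 κ ≠ 0) : AnalyticAt ℂ (Fsym r p a0 a1) κ :=
  (symbol_analyticAt r p a0 κ hκ).div (symbol_analyticAt r p a1 κ hκ) h1

theorem Setup.deriv_F (S : Setup) (k : Fin S.K) :
    deriv S.F (S.kap k) = - (S.α k : ℂ) * S.zK k / S.kap k := by
  have hk0 : S.kap k ≠ 0 := by
    intro h; have := S.hkap_unit k; simp [h] at this
  have hz0 : S.zK k ≠ 0 := by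
    intro h; have := S.hF_unit k
    rw [show Fsym S.r S.p S.a0 S.a1 (S.kap k) = S.zK k from rfl, h] at this; simp at this
  have hF := (Fsym_analyticAt S.r S.p S.a0 S.a1 (S.kap k) hk0
    (S.hQ1_ne _ (S.hkap_unit k))).differentiableAt.hasDerivAt
  obtain ⟨g, hg, he⟩ := S.hexp k
  -- derivative of the exponent
  have hμ := S.hμ k
  have hg' : g =O[nhds 0] fun ξ : ℝ => ‖ξ - 0‖ ^ (2 * S.μ k + 1) := by
    simpa [← norm_pow] using hg.norm_right
  have hg0 : g 0 = 0 := hg'.eq_zero_of_norm_pow (by omega)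
  have hg1 : HasDerivAt g 0 0 := by
    have := (hg'.hasFDerivAt (𝕜 := ℝ) (by omega)).hasDerivAt
    simpa using this
  have hid : HasDerivAt (fun ξ : ℝ => (ξ : ℂ)) 1 0 := Complex.ofRealCLM.hasDerivAt
  have hpow : HasDerivAt (fun ξ : ℝ => (ξ : ℂ) ^ (2 * S.μ k)) 0 0 := by
    have := hid.fun_pow (2 * S.μ k)
    have h2 : 2 * S.μ k - 1 ≠ 0 := by omega
    simpa [h2] using this
  have hE := (((hid.const_mul (-(Complex.I) * (S.α k : ℂ))).sub
    (hpow.const_mul (S.β k : ℂ))).add hg1).cexp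
  have hL : HasDerivAt (fun ξ : ℝ => S.kap k * Complex.exp (Complex.I * ξ))
      (S.kap k * Complex.I) 0 := by
    have := ((hid.const_mul Complex.I).cexp).const_mul (S.kap k)
    simpa using this
  have hF' : HasDerivAt (Fsym S.r S.p S.a0 S.a1) (deriv S.F (S.kap k))
      (S.kap k * Complex.exp (Complex.I * ((0 : ℝ) : ℂ))) := by
    rw [show S.kap k * Complex.exp (Complex.I * ((0 : ℝ) : ℂ)) = S.kap k by simp]
    exact hF
  have hC := (hF'.comp (0 : ℝ) hL).div_const (Fsym S.r S.p S.a0 S.a1 (S.kap k))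
  have hC2 := hC.congr_of_eventuallyEq (f₁ := fun ξ : ℝ => Complex.exp (-(Complex.I) * (S.α k : ℂ) * (ξ : ℂ)
            - (S.β k : ℂ) * (ξ : ℂ) ^ (2 * S.μ k) + g ξ)) (by
      filter_upwards [he] with ξ hξ using hξ.symm)
  have hu := hC2.unique hE
  rw [show Fsym S.r S.p S.a0 S.a1 (S.kap k) = S.zK k from rfl] at hu
  have hm0 : S.μ k ≠ 0 := by omega
  simp [hg0, hm0] at hu
  rw [eq_div_iff hk0]
  rw [div_eq_iff hz0] at hu
  have : Complex.I * (deriv S.F (S.kap k) * S.kap k) = Complex.I * (-(S.α k : ℂ) * S.zK k) := by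
    linear_combination hu
  exact mul_left_cancel₀ Complex.I_ne_zero this

theorem taylor_two (f : ℂ → ℂ) (z : ℂ) (hf : AnalyticAt ℂ f z) :
    (fun h : ℂ => f (z + h) - (f z + h * deriv f z)) =O[nhds 0] fun h : ℂ => ‖h‖ ^ 2 := by
  obtain ⟨q, hq⟩ := hf
  have h := hq.isBigO_sub_partialSum_pow 2
  have hd : deriv f z = q.coeff 1 := hq.deriv
  refine h.congr_left fun y => ?_
  rw [FormalMultilinearSeries.partialSum, Finset.sum_range_succ, Finset.sum_range_one]
  rw [FormalMultilinearSeries.apply_eq_pow_smul_coeff,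
    FormalMultilinearSeries.apply_eq_pow_smul_coeff, hd]
  have h0 : q.coeff 0 = f z := hq.coeff_zero _
  rw [h0]; simp

theorem charpoly_simple (r p : ℕ) (a0 a1 : ℤ → ℂ) (z κ : ℂ) (hκ : κ ≠ 0)
    (hA : Acoef a0 a1 (p : ℤ) z ≠ 0) (h1 : symbol r p a1 κ ≠ 0)
    (hF : Fsym r p a0 a1 κ = z) (hF' : deriv (Fsym r p a0 a1) κ ≠ 0) :
    Polynomial.rootMultiplicity κ (Mmat r p a0 a1 z).charpoly = 1 := by
  have hne : (Mmat r p a0 a1 z).charpoly ≠ 0 := (Matrix.charpoly_monic _).ne_zero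
  have h1a := symbol_analyticAt r p a1 κ hκ
  have hFa := Fsym_analyticAt r p a0 a1 κ hκ h1
  have hroot : (Mmat r p a0 a1 z).charpoly.IsRoot κ := by
    rw [Polynomial.IsRoot, charpoly_eval r p a0 a1 z κ hκ hA]
    have : z * symbol r p a1 κ - symbol r p a0 κ = 0 := by
      rw [← hF, Fsym, div_mul_cancel₀ _ h1, sub_self]
    rw [this]; simp
  have hpos := (Polynomial.rootMultiplicity_pos hne).2 hroot
  have hle : ¬ 1 < Polynomial.rootMultiplicity κ (Mmat r p a0 a1 z).charpoly := by
    rw [Polynomial.one_lt_rootMultiplicity_iff_isRoot hne]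
    rintro ⟨-, hd⟩
    have hev : (fun w => (Mmat r p a0 a1 z).charpoly.eval w) =ᶠ[nhds κ]
        fun w => (w ^ r * symbol r p a1 w / Acoef a0 a1 (p : ℤ) z) *
          (z - Fsym r p a0 a1 w) := by
      filter_upwards [h1a.continuousAt.eventually_ne h1, eventually_ne_nhds hκ] with w hw hw0
      rw [charpoly_eval r p a0 a1 z w hw0 hA, Fsym]
      field_simp
    have hG : DifferentiableAt ℂ (fun w => w ^ r * symbol r p a1 w / Acoef a0 a1 (p : ℤ) z) κ :=
      ((differentiableAt_id.pow r).mul h1a.differentiableAt).div_const _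
    have hder := (hG.hasDerivAt.mul
      (hFa.differentiableAt.hasDerivAt.const_sub z)).congr_of_eventuallyEq hev
    have hu := hder.unique ((Mmat r p a0 a1 z).charpoly.hasDerivAt κ)
    rw [hd.eq_zero, hF, sub_self, mul_zero, zero_add] at hu
    have : κ ^ r * symbol r p a1 κ / Acoef a0 a1 (p : ℤ) z ≠ 0 :=
      div_ne_zero (mul_ne_zero (pow_ne_zero _ hκ) h1) hA
    exact mul_ne_zero this (neg_ne_zero.2 hF') hu
  omega

/-- If `ℐ_k = {k}` is a singleton, the simple eigenvalue `κ̲_k` of `𝕄(z̲_k)` extends to a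
holomorphic family `κ_k(z)` of simple eigenvalues of `𝕄(z)` near `z̲_k`, with `F(κ_k(z)) = z`,
Taylor expansion `κ_k(z̲_k(1+ε'))/κ̲_k = 1 - ε'/α_k + O(ε'²)`, and in particular
`κ_k(z̲_k(1+ε')) ∈ 𝔻` (resp. `∈ 𝒰`) for small `ε' > 0` when `α_k > 0` (resp. `α_k < 0`). -/
theorem holomorphic_eigenvalue_singleton (S : Setup) (k : Fin S.K)
    (hsing : ∀ ν, S.zK ν = S.zK k → ν = k) :
    ∃ ε > (0 : ℝ), ∃ κf : ℂ → ℂ,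
      DifferentiableOn ℂ κf (ball (S.zK k) ε) ∧
      κf (S.zK k) = S.kap k ∧
      (∀ z ∈ ball (S.zK k) ε,
        Polynomial.rootMultiplicity (κf z) (S.M z).charpoly = 1 ∧ S.F (κf z) = z) ∧
      ((fun ε' : ℝ => κf (S.zK k * (1 + (ε' : ℂ))) / S.kap k - (1 - (ε' : ℂ) / (S.α k : ℂ)))
        =O[nhds 0] fun ε' : ℝ => ε' ^ 2) ∧
      (0 < S.α k → ∀ᶠ ε' : ℝ in nhdsWithin 0 (Set.Ioi 0),
        ‖κf (S.zK k * (1 + (ε' : ℂ)))‖ < 1) ∧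
      (S.α k < 0 → ∀ᶠ ε' : ℝ in nhdsWithin 0 (Set.Ioi 0),
        1 < ‖κf (S.zK k * (1 + (ε' : ℂ)))‖) := by
  have hk0 : S.kap k ≠ 0 := by
    intro h; have := S.hkap_unit k; simp [h] at this
  have hznorm : ‖S.zK k‖ = 1 := S.hF_unit k
  have hz0 : S.zK k ≠ 0 := by
    intro h; simp [h] at hznorm
  have hα0 : (S.α k : ℂ) ≠ 0 := by exact_mod_cast S.hα k
  have h1 := S.hQ1_ne _ (S.hkap_unit k)
  have hFa : AnalyticAt ℂ S.F (S.kap k) := Fsym_analyticAt S.r S.p S.a0 S.a1 (S.kap k) hk0 h1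
  have hd := S.deriv_F k
  have hd0 : deriv S.F (S.kap k) ≠ 0 := by
    rw [hd]; exact div_ne_zero (mul_ne_zero (neg_ne_zero.2 hα0) hz0) hk0
  obtain ⟨κf, hκa, hκ0, hinv, hκd⟩ : ∃ κf : ℂ → ℂ, AnalyticAt ℂ κf (S.zK k) ∧
      κf (S.zK k) = S.kap k ∧ (∀ᶠ z in nhds (S.zK k), S.F (κf z) = z) ∧
      deriv κf (S.zK k) = (deriv S.F (S.kap k))⁻¹ :=
    ⟨hFa.hasStrictDerivAt.localInverse _ _ _ hd0, hFa.analyticAt_localInverse hd0,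
      HasStrictFDerivAt.localInverse_apply_image ..,
      hFa.hasStrictDerivAt.eventually_right_inverse hd0,
      (hFa.hasStrictDerivAt.to_localInverse hd0).hasDerivAt.deriv⟩
  have hκt : Tendsto κf (nhds (S.zK k)) (nhds (S.kap k)) := by
    have := hκa.continuousAt.tendsto; rwa [hκ0] at this
  have hAc : ContinuousAt (Acoef S.a0 S.a1 (S.p : ℤ)) (S.zK k) := by
    unfold Acoef; fun_prop
  have hev : ∀ᶠ z in nhds (S.zK k), DifferentiableAt ℂ κf z ∧
      Polynomial.rootMultiplicity (κf z) (S.M z).charpoly = 1 ∧ S.F (κf z) = z := by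
    filter_upwards [hκa.eventually_analyticAt, hinv,
      hAc.eventually_ne (S.hA _ hznorm.ge).2,
      hκt.eventually (eventually_ne_nhds hk0),
      hκt.eventually ((symbol_analyticAt S.r S.p S.a1 _ hk0).continuousAt.eventually_ne h1),
      hκt.eventually (hFa.deriv.continuousAt.eventually_ne hd0)] with z h2 h3 h4 h5 h6 h7
    exact ⟨h2.differentiableAt, charpoly_simple _ _ _ _ _ _ h5 h4 h6 h3 h7, h3⟩
  obtain ⟨ε, hε, hball⟩ := Metric.eventually_nhds_iff_ball.1 hev
  have hT : (fun ε' : ℝ => κf (S.zK k * (1 + (ε' : ℂ))) / S.kap k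
      - (1 - (ε' : ℂ) / (S.α k : ℂ))) =O[nhds 0] fun ε' : ℝ => ε' ^ 2 := by
    have ht : Tendsto (fun ε' : ℝ => S.zK k * (ε' : ℂ)) (nhds 0) (nhds 0) := by
      have : Continuous fun ε' : ℝ => S.zK k * (ε' : ℂ) := by fun_prop
      simpa using this.tendsto 0
    have h := ((taylor_two κf _ hκa).comp_tendsto ht).const_mul_left (S.kap k)⁻¹
    refine (h.congr_left fun x => ?_).trans (IsBigO.of_bound 1 ?_)
    · simp only [Function.comp, hκ0, hκd, hd]
      rw [show S.zK k * (1 + (x : ℂ)) = S.zK k + S.zK k * x by ring]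
      field_simp
      ring
    · refine Eventually.of_forall fun x => ?_
      simp [hznorm]
  have hlo : ∀ᶠ ε' : ℝ in nhdsWithin 0 (Set.Ioi 0),
      ‖κf (S.zK k * (1 + (ε' : ℂ))) / S.kap k - (1 - (ε' : ℂ) / (S.α k : ℂ))‖
        ≤ (2 * |S.α k|)⁻¹ * ε' ∧ 0 < ε' ∧ ε' < |S.α k| := by
    have hpos : 0 < |S.α k| := abs_pos.2 (S.hα k)
    have h2 : (fun ε' : ℝ => ε' ^ 2) =o[nhds 0] fun ε' : ℝ => ε' := by
      simpa using isLittleO_pow_pow (𝕜 := ℝ) (m := 1) (n := 2) (by norm_num)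
    have h3 := (hT.trans_isLittleO h2).def (c := (2 * |S.α k|)⁻¹) (by positivity)
    filter_upwards [nhdsWithin_le_nhds h3, self_mem_nhdsWithin,
      nhdsWithin_le_nhds (Iio_mem_nhds hpos)] with x hx hx0 hx1
    have hx0' : 0 < x := hx0
    rw [Real.norm_of_nonneg hx0'.le] at hx
    exact ⟨hx, hx0', hx1⟩
  have hn : ∀ w : ℂ, ‖w / S.kap k‖ = ‖w‖ := by
    intro w; rw [norm_div, S.hkap_unit k, div_one]
  have hr : ∀ x : ℝ, ‖(1 - (x : ℂ) / (S.α k : ℂ))‖ = |1 - x / S.α k| := by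
    intro x
    rw [← Real.norm_eq_abs, ← Complex.norm_real]; push_cast; rfl
  refine ⟨ε, hε, κf, fun z hz => (hball z hz).1.differentiableWithinAt, hκ0,
    fun z hz => (hball z hz).2, hT, ?_, ?_⟩
  · intro hα
    filter_upwards [hlo] with x hx
    obtain ⟨hx, hx0, hx1⟩ := hx
    rw [abs_of_pos hα] at hx hx1
    have h3 := norm_sub_norm_le (κf (S.zK k * (1 + (x : ℂ))) / S.kap k)
      (1 - (x : ℂ) / (S.α k : ℂ))
    have h4 : 0 < x / S.α k := by positivity
    have h5 : x / S.α k < 1 := (div_lt_one hα).2 hx1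
    have h6 : (2 * S.α k)⁻¹ * x = x / S.α k / 2 := by field_simp
    rw [hn, hr, abs_of_pos (by linarith)] at h3
    linarith
  · intro hα
    filter_upwards [hlo] with x hx
    obtain ⟨hx, hx0, hx1⟩ := hx
    rw [abs_of_neg hα] at hx hx1
    have h3 := norm_sub_norm_le (1 - (x : ℂ) / (S.α k : ℂ))
      (κf (S.zK k * (1 + (x : ℂ))) / S.kap k)
    rw [norm_sub_rev] at hx
    have h4 : x / S.α k < 0 := div_neg_of_pos_of_neg hx0 hα
    have h6 : (2 * -S.α k)⁻¹ * x = -(x / S.α k) / 2 := by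
      have := hα.ne
      field_simp
    rw [hn, hr, abs_of_pos (by linarith)] at h3
    linarith
end
end

section
/- Under Assumptions 1–5, assume additionally that Q₁ is not the identity (implicit case, so a_{−r,1} ≠ 0 and a_{p,1} ≠ 0). Then there exist a radius R ≥ 2 and constants C > 0, c > 0 such that for every z ∈ ℂ with |z| ≥ R (such z lies outside the spectrum of ℒ) and every j ∈ ℤ, the spatial Green's function satisfies |G_z(j)| ≤ C exp(−c |j|). -/
open scoped Classical
open Complex Filter Asymptotics Metric

noncomputable section

set_option autoImplicit false

/-- Laurent-type coefficients of a function on the unit circle. -/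
def lcoef (h : ℂ → ℂ) (j : ℤ) : ℂ :=
  (2 * (Real.pi : ℂ) * Complex.I)⁻¹ • ∮ κ in C(0, 1), (κ - 0)⁻¹ • (h κ * κ ^ j)

/-- The closed annulus `1/ρ ≤ |κ| ≤ ρ`. -/
def ann (ρ : ℝ) : Set ℂ := {κ | ρ⁻¹ ≤ ‖κ‖ ∧ ‖κ‖ ≤ ρ}

lemma ann_ne_zero {ρ : ℝ} (hρ : 1 < ρ) {κ : ℂ} (h : κ ∈ ann ρ) : κ ≠ 0 := by
  rintro rfl
  have h1 := h.1
  have : 0 < ρ⁻¹ := by positivity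
  simp at h1
  linarith

lemma sphere_mem_ann {ρ : ℝ} (hρ : 1 < ρ) {κ : ℂ} (h : ‖κ‖ = 1) : κ ∈ ann ρ := by
  refine ⟨?_, ?_⟩
  · rw [h]; exact (inv_lt_one_of_one_lt₀ hρ).le
  · rw [h]; exact hρ.le

lemma lcoef_bound {ρ : ℝ} (hρ : 1 < ρ) {h : ℂ → ℂ}
    (hd : ∀ κ ∈ ann ρ, DifferentiableAt ℂ h κ) {M : ℝ} (hM : ∀ κ ∈ ann ρ, ‖h κ‖ ≤ M) (j : ℤ) :
    ‖lcoef h j‖ ≤ M * ρ⁻¹ ^ j.natAbs := by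
  have hρ0 : 0 < ρ := by linarith
  have hρi : ρ⁻¹ < 1 := inv_lt_one_of_one_lt₀ hρ
  have hd' : ∀ κ ∈ ann ρ, DifferentiableAt ℂ (fun κ => h κ * κ ^ j) κ := by
    intro κ hκ
    exact (hd κ hκ).mul (differentiableAt_zpow.2 (Or.inl (ann_ne_zero hρ hκ)))
  have key : ∀ s : ℝ, 0 < s → s ∈ Set.Icc ρ⁻¹ ρ →
      (∮ κ in C(0, 1), (κ - 0)⁻¹ • (h κ * κ ^ j)) = ∮ κ in C(0, s), (κ - 0)⁻¹ • (h κ * κ ^ j) := by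
    intro s hs0 hs
    rcases le_total 1 s with h1 | h1
    · symm
      apply Complex.circleIntegral_sub_center_inv_smul_eq_of_differentiable_on_annulus_off_countable
        one_pos h1 Set.countable_empty
      · intro κ hκ
        simp at hκ
        exact (hd' κ ⟨by linarith [hκ.2], by linarith [hκ.1, hs.2]⟩).continuousAt.continuousWithinAt
      · intro κ hκ
        simp at hκ
        exact hd' κ ⟨by linarith [hκ.2], by linarith [hκ.1, hs.2]⟩
    · apply Complex.circleIntegral_sub_center_inv_smul_eq_of_differentiable_on_annulus_off_countable
        hs0 h1 Set.countable_empty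
      · intro κ hκ
        simp at hκ
        exact (hd' κ ⟨by linarith [hκ.2, hs.1], by linarith [hκ.1]⟩).continuousAt.continuousWithinAt
      · intro κ hκ
        simp at hκ
        exact hd' κ ⟨by linarith [hκ.2, hs.1], by linarith [hκ.1]⟩
  have bd : ∀ s : ℝ, 0 < s → s ∈ Set.Icc ρ⁻¹ ρ → ‖lcoef h j‖ ≤ M * s ^ j := by
    intro s hs0 hs
    unfold lcoef
    rw [key s hs0 hs]
    have := circleIntegral.norm_two_pi_i_inv_smul_integral_le_of_norm_le_const
      (f := fun κ : ℂ => (κ - 0)⁻¹ • (h κ * κ ^ j)) (c := 0) (R := s) (C := s⁻¹ * (M * s ^ j))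
      hs0.le (by
        intro κ hκ
        have hn : ‖κ‖ = s := by simpa using hκ
        have := hM κ ⟨by rw [hn]; exact hs.1, by rw [hn]; exact hs.2⟩
        simp only [sub_zero, smul_eq_mul, norm_mul, norm_inv, norm_zpow, hn]
        gcongr)
    refine this.trans_eq ?_
    field_simp
  rcases le_total 0 j with h0 | h0
  · have := bd ρ⁻¹ (by positivity) ⟨le_rfl, by linarith⟩
    obtain ⟨n, rfl⟩ := Int.eq_ofNat_of_zero_le h0
    simpa using this
  · have := bd ρ hρ0 ⟨by linarith, le_rfl⟩
    obtain ⟨n, hn⟩ := Int.eq_ofNat_of_zero_le (neg_nonneg.2 h0)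
    obtain rfl : j = -(n : ℤ) := by omega
    simpa using this

lemma lcoef_congr {f g : ℂ → ℂ} (h : ∀ κ : ℂ, ‖κ‖ = 1 → f κ = g κ) (j : ℤ) :
    lcoef f j = lcoef g j := by
  unfold lcoef
  congr 1
  apply circleIntegral.integral_congr zero_le_one
  intro κ hκ
  have hn : ‖κ‖ = 1 := by simpa using hκ
  simp only [h κ hn]

lemma conv_lcoef {ρ : ℝ} (hρ : 1 < ρ) (r p : ℕ) (a : ℤ → ℂ) {h : ℂ → ℂ}
    (hd : ∀ κ ∈ ann ρ, DifferentiableAt ℂ h κ) (j : ℤ) :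
    convAct r p a (lcoef h) j = lcoef (fun κ => symbol r p a κ * h κ) j := by
  have hne : ∀ κ ∈ sphere (0 : ℂ) 1, κ ≠ 0 := by
    rintro κ hκ rfl
    simp at hκ
  have e : (∮ κ in C(0, 1), (κ - 0)⁻¹ • (symbol r p a κ * h κ * κ ^ j)) =
      ∮ κ in C(0, 1), ∑ ℓ ∈ Finset.Icc (-(r : ℤ)) (p : ℤ),
        a ℓ * ((κ - 0)⁻¹ • (h κ * κ ^ (j + ℓ))) := by
    apply circleIntegral.integral_congr zero_le_one
    intro κ hκ
    simp only [symbol, Finset.sum_mul, Finset.mul_sum, smul_eq_mul]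
    refine Finset.sum_congr rfl fun ℓ _ => ?_
    rw [zpow_add₀ (hne κ hκ)]
    ring
  unfold convAct lcoef
  rw [e, circleIntegral.integral_fun_sum]
  · rw [Finset.smul_sum]
    refine Finset.sum_congr rfl fun ℓ _ => ?_
    rw [circleIntegral.integral_const_mul]
    simp only [smul_eq_mul]
    ring
  · intro ℓ _
    apply ContinuousOn.circleIntegrable zero_le_one
    intro κ hκ
    have h0 := hne κ hκ
    have hn : ‖κ‖ = 1 := by simpa using hκ
    have h1 := (hd κ (sphere_mem_ann hρ hn)).continuousAt
    have h2 : ContinuousAt (fun κ : ℂ => κ ^ (j + ℓ)) κ := continuousAt_zpow₀ _ _ (Or.inl h0)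
    have h3 : ContinuousAt (fun κ : ℂ => (κ - 0)⁻¹) κ := by
      simpa using continuousAt_inv₀ h0
    exact (continuousAt_const.mul (h3.smul (h1.mul h2))).continuousWithinAt

lemma lcoef_one (j : ℤ) : lcoef (fun _ => 1) j = if j = 0 then 1 else 0 := by
  have hne : ∀ κ ∈ sphere (0 : ℂ) 1, κ ≠ 0 := by
    rintro κ hκ rfl
    simp at hκ
  have e : (∮ κ in C(0, 1), (κ - 0)⁻¹ • ((1 : ℂ) * κ ^ j)) = ∮ κ in C(0, 1), (κ - 0) ^ (j - 1) := by
    apply circleIntegral.integral_congr zero_le_one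
    intro κ hκ
    simp only [sub_zero, smul_eq_mul, one_mul]
    rw [zpow_sub_one₀ (hne κ hκ), mul_comm]
  unfold lcoef
  rw [e]
  split_ifs with h
  · subst h
    have := circleIntegral.integral_sub_center_inv (0 : ℂ) (R := 1) one_ne_zero
    simp only [zero_sub, zpow_neg_one, this, smul_eq_mul]
    exact inv_mul_cancel₀ (by simp [Real.pi_ne_zero])
  · rw [circleIntegral.integral_sub_zpow_of_ne (by omega)]
    simp

lemma symbol_diff (r p : ℕ) (a : ℤ → ℂ) {κ : ℂ} (h : κ ≠ 0) :
    DifferentiableAt ℂ (symbol r p a) κ := by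
  unfold symbol
  apply DifferentiableAt.fun_sum
  intro ℓ _
  exact (differentiableAt_const _).mul (differentiableAt_zpow.2 (Or.inl h))

lemma exists_annulus (r p : ℕ) (a : ℤ → ℂ) (h : ∀ κ : ℂ, ‖κ‖ = 1 → symbol r p a κ ≠ 0) :
    ∃ ρ : ℝ, 1 < ρ ∧ ∀ κ ∈ ann ρ, symbol r p a κ ≠ 0 := by
  have hopen : IsOpen {κ : ℂ | κ ≠ 0 ∧ symbol r p a κ ≠ 0} := by
    rw [isOpen_iff_mem_nhds]
    rintro κ ⟨h0, h1⟩
    have e1 : ∀ᶠ x in nhds κ, x ≠ 0 := isOpen_ne.mem_nhds h0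
    have e2 := (symbol_diff r p a h0).continuousAt.eventually_ne h1
    filter_upwards [e1, e2] with x hx hy using ⟨hx, hy⟩
  obtain ⟨δ, hδ, hsub⟩ := (isCompact_sphere (0 : ℂ) 1).exists_cthickening_subset_open hopen (by
    intro κ hκ
    have hn : ‖κ‖ = 1 := by simpa using hκ
    exact ⟨by rintro rfl; simp at hn, h κ hn⟩)
  refine ⟨1 + δ, by linarith, fun κ hκ => ?_⟩
  have h0 := ann_ne_zero (by linarith) hκ
  have hk0 : 0 < ‖κ‖ := norm_pos_iff.2 h0
  refine (hsub (mem_cthickening_of_dist_le κ (κ / ‖κ‖) δ _ ?_ ?_)).2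
  · simp [hk0.ne']
  · have e : κ - κ / ‖κ‖ = κ * (((‖κ‖ - 1) / ‖κ‖ : ℝ) : ℂ) := by
      have : (‖κ‖ : ℂ) ≠ 0 := by exact_mod_cast hk0.ne'
      push_cast
      field_simp
    rw [dist_eq_norm, e, norm_mul, Complex.norm_real, norm_div, Real.norm_eq_abs, norm_norm,
      mul_div_cancel₀ _ hk0.ne', abs_le]
    obtain ⟨h1, h2⟩ := hκ
    refine ⟨?_, by linarith⟩
    have : 1 - δ ≤ (1 + δ)⁻¹ := by
      rw [← one_div, le_div_iff₀ (by linarith)]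
      nlinarith
    linarith

lemma summable_ann {ρ : ℝ} (hρ : 1 < ρ) : Summable fun j : ℤ => ρ⁻¹ ^ j.natAbs := by
  have h1 : Summable fun n : ℕ => ρ⁻¹ ^ n :=
    summable_geometric_of_lt_one (by positivity) (inv_lt_one_of_one_lt₀ hρ)
  exact Summable.of_nat_of_neg (by simpa using h1) (by simpa using h1)

/-- Injectivity of a convolution operator with non-vanishing symbol on bounded sequences. -/
lemma conv_inj (r p : ℕ) (a : ℤ → ℂ) (h : ∀ κ : ℂ, ‖κ‖ = 1 → symbol r p a κ ≠ 0)
    (u : ℤ → ℂ) (B : ℝ) (hB : ∀ j, ‖u j‖ ≤ B) (hu : ∀ j, convAct r p a u j = 0) (j : ℤ) :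
    u j = 0 := by
  obtain ⟨ρ, hρ, hs⟩ := exists_annulus r p a h
  have hd : ∀ κ ∈ ann ρ, DifferentiableAt ℂ (fun κ => (symbol r p a κ)⁻¹) κ := fun κ hκ =>
    (symbol_diff r p a (ann_ne_zero hρ hκ)).inv (hs κ hκ)
  have hcomp : IsCompact (ann ρ) := by
    have : ann ρ = closedBall 0 ρ ∩ {κ : ℂ | ρ⁻¹ ≤ ‖κ‖} := by
      ext κ; simp [ann, and_comm]
    rw [this]
    exact (isCompact_closedBall _ _).inter_right (isClosed_le continuous_const continuous_norm)
  obtain ⟨M, hM⟩ := hcomp.exists_bound_of_continuousOn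
    (fun κ hκ => (hd κ hκ).continuousAt.continuousWithinAt)
  set b := lcoef (fun κ => (symbol r p a κ)⁻¹) with hb
  have hbb : ∀ k, ‖b k‖ ≤ M * ρ⁻¹ ^ k.natAbs := lcoef_bound hρ hd hM
  have hconv : ∀ m, ∑ ℓ ∈ Finset.Icc (-(r : ℤ)) (p : ℤ), a ℓ * b (m + ℓ) = if m = 0 then 1 else 0 := by
    intro m
    have := conv_lcoef hρ r p a hd m
    rw [lcoef_congr (g := fun _ => 1) (fun κ hκ => mul_inv_cancel₀ (h κ hκ)), lcoef_one] at this
    exact this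
  have hbs : Summable fun k => ‖b k‖ :=
    Summable.of_nonneg_of_le (fun _ => norm_nonneg _) hbb ((summable_ann hρ).mul_left M)
  have hsum : ∀ ℓ : ℤ, Summable fun k : ℤ => a ℓ * (b k * u (j - k + ℓ)) := by
    intro ℓ
    apply Summable.mul_left
    apply Summable.of_norm_bounded (hbs.mul_right B)
    intro k
    rw [norm_mul]
    gcongr
    exact hB _
  have h1 : (∑' k : ℤ, b k * convAct r p a u (j - k)) =
      ∑ ℓ ∈ Finset.Icc (-(r : ℤ)) (p : ℤ), ∑' k : ℤ, a ℓ * (b k * u (j - k + ℓ)) := by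
    rw [← Summable.tsum_finsetSum (fun ℓ _ => hsum ℓ)]
    refine tsum_congr fun k => ?_
    unfold convAct
    rw [Finset.mul_sum]
    exact Finset.sum_congr rfl fun ℓ _ => by ring
  have h2 : ∀ ℓ : ℤ, (∑' k : ℤ, a ℓ * (b k * u (j - k + ℓ))) =
      ∑' m : ℤ, a ℓ * (b (m + ℓ) * u (j - m)) := by
    intro ℓ
    rw [← (Equiv.addRight ℓ).tsum_eq]
    refine tsum_congr fun m => ?_
    simp only [Equiv.coe_addRight]
    rw [show j - (m + ℓ) + ℓ = j - m by ring]
  have hsum' : ∀ ℓ : ℤ, Summable fun m : ℤ => a ℓ * (b (m + ℓ) * u (j - m)) := by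
    intro ℓ
    have := (Equiv.addRight ℓ).summable_iff.2 (hsum ℓ)
    refine this.congr fun m => ?_
    simp only [Function.comp, Equiv.coe_addRight]
    rw [show j - (m + ℓ) + ℓ = j - m by ring]
  simp only [hu, mul_zero, tsum_zero, h2] at h1
  rw [← Summable.tsum_finsetSum (fun ℓ _ => hsum' ℓ)] at h1
  have h3 : ∀ m : ℤ, (∑ ℓ ∈ Finset.Icc (-(r : ℤ)) (p : ℤ), a ℓ * (b (m + ℓ) * u (j - m))) =
      if m = 0 then u j else 0 := by
    intro m
    simp only [← mul_assoc]
    rw [← Finset.sum_mul, hconv]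
    split_ifs with hm
    · simp [hm]
    · simp
  simp only [h3, tsum_ite_eq] at h1
  exact h1.symm

/-- Lemma 5 (bounds at infinity, implicit case): if `Q₁` is not the identity, there are `R ≥ 2`
and `C, c > 0` such that for `|z| ≥ R`, `z` is in the resolvent set of `ℒ` and the spatial
Green's function satisfies `|G_z(j)| ≤ C e^{-c|j|}`. -/
theorem green_bound_at_infinity (S : Setup)
    (himp : ¬ ∀ ℓ ∈ Finset.Icc (-(S.r : ℤ)) (S.p : ℤ), S.a1 ℓ = if ℓ = 0 then 1 else 0) :
    ∃ R : ℝ, 2 ≤ R ∧ ∃ C > (0 : ℝ), ∃ c > (0 : ℝ), ∀ z : ℂ, R ≤ ‖z‖ →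
      z ∉ spectrum ℂ S.L ∧
      ∃ G : Seq2, z • G - S.L G = dirac ∧
        ∀ j : ℤ, ‖G j‖ ≤ C * Real.exp (-c * |(j : ℝ)|) := by
  obtain ⟨ρ, hρ, hs⟩ := exists_annulus S.r S.p S.a1 S.hQ1_ne
  have hFd : ∀ κ ∈ ann ρ, DifferentiableAt ℂ (Fsym S.r S.p S.a0 S.a1) κ := fun κ hκ =>
    (symbol_diff S.r S.p S.a0 (ann_ne_zero hρ hκ)).div
      (symbol_diff S.r S.p S.a1 (ann_ne_zero hρ hκ)) (hs κ hκ)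
  have hcomp : IsCompact (ann ρ) := by
    have : ann ρ = closedBall 0 ρ ∩ {κ : ℂ | ρ⁻¹ ≤ ‖κ‖} := by
      ext κ; simp [ann, and_comm]
    rw [this]
    exact (isCompact_closedBall _ _).inter_right (isClosed_le continuous_const continuous_norm)
  obtain ⟨M, hM⟩ := hcomp.exists_bound_of_continuousOn
    (fun κ hκ => (hFd κ hκ).continuousAt.continuousWithinAt)
  have hM0 : 0 ≤ M := (norm_nonneg _).trans (hM 1 (sphere_mem_ann hρ (by simp)))
  have hN : 0 ≤ ‖S.L‖ * ‖(1 : Seq2 →L[ℂ] Seq2)‖ := by positivity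
  refine ⟨M + ‖S.L‖ * ‖(1 : Seq2 →L[ℂ] Seq2)‖ + 2, by linarith, 1, one_pos, Real.log ρ,
    Real.log_pos hρ, fun z hz => ⟨fun hmem => ?_, ?_⟩⟩
  · have := spectrum.norm_le_norm_mul_of_mem hmem
    linarith
  have hlow : ∀ κ ∈ ann ρ, 1 ≤ ‖z - Fsym S.r S.p S.a0 S.a1 κ‖ := by
    intro κ hκ
    have h1 := hM κ hκ
    have h2 := norm_sub_norm_le z (Fsym S.r S.p S.a0 S.a1 κ)
    linarith
  have hne : ∀ κ ∈ ann ρ, z - Fsym S.r S.p S.a0 S.a1 κ ≠ 0 := by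
    intro κ hκ h0
    have := hlow κ hκ
    rw [h0, norm_zero] at this
    linarith
  set h : ℂ → ℂ := fun κ => (z - Fsym S.r S.p S.a0 S.a1 κ)⁻¹ with hh
  have hd : ∀ κ ∈ ann ρ, DifferentiableAt ℂ h κ := fun κ hκ =>
    ((differentiableAt_const z).sub (hFd κ hκ)).inv (hne κ hκ)
  have hb : ∀ κ ∈ ann ρ, ‖h κ‖ ≤ 1 := by
    intro κ hκ
    rw [hh, norm_inv]
    exact inv_le_one_of_one_le₀ (hlow κ hκ)
  have hGb := lcoef_bound hρ hd hb
  have hmem : Memℓp (lcoef h) 2 := by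
    have h1 : Memℓp (lcoef h) 1 := by
      apply memℓp_gen
      simp only [ENNReal.toReal_one, Real.rpow_one]
      exact Summable.of_nonneg_of_le (fun _ => norm_nonneg _) hGb ((summable_ann hρ).mul_left 1)
    exact h1.of_exponent_ge (by norm_num)
  let G : Seq2 := ⟨lcoef h, hmem⟩
  have hdirac : ∀ j : ℤ, dirac j = lcoef (fun _ => 1) j := by
    intro j
    rw [lcoef_one]
    simp [dirac, lp.single_apply, Pi.single_apply]
  have e0 : ∀ j, convAct S.r S.p S.a1 (fun i => (z • G - S.L G - dirac) i) j = 0 := by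
    intro j
    have e1 : convAct S.r S.p S.a1 (fun i => (z • G - S.L G - dirac) i) j =
        z * convAct S.r S.p S.a1 (lcoef h) j - convAct S.r S.p S.a1 (fun i => S.L G i) j
          - convAct S.r S.p S.a1 (lcoef (fun _ => 1)) j := by
      simp only [convAct, Finset.mul_sum, ← Finset.sum_sub_distrib]
      refine Finset.sum_congr rfl fun ℓ _ => ?_
      rw [← hdirac]
      change S.a1 ℓ * (z * lcoef h (j + ℓ) - S.L G (j + ℓ) - dirac (j + ℓ)) = _
      ring
    have e2 : z * convAct S.r S.p S.a1 (lcoef h) j - convAct S.r S.p S.a0 (lcoef h) j =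
        convAct S.r S.p (fun ℓ => z * S.a1 ℓ - S.a0 ℓ) (lcoef h) j := by
      simp only [convAct, Finset.mul_sum, ← Finset.sum_sub_distrib]
      exact Finset.sum_congr rfl fun ℓ _ => by ring
    rw [e1, S.hL]
    change z * convAct S.r S.p S.a1 (lcoef h) j - convAct S.r S.p S.a0 (lcoef h) j - _ = 0
    rw [e2, conv_lcoef hρ _ _ _ hd, conv_lcoef hρ _ _ _ (fun κ _ => differentiableAt_const 1),
      sub_eq_zero]
    apply lcoef_congr
    intro κ hκ
    have hκ' := sphere_mem_ann hρ hκ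
    have e3 : symbol S.r S.p (fun ℓ => z * S.a1 ℓ - S.a0 ℓ) κ =
        z * symbol S.r S.p S.a1 κ - symbol S.r S.p S.a0 κ := by
      simp only [symbol, Finset.mul_sum, ← Finset.sum_sub_distrib]
      exact Finset.sum_congr rfl fun ℓ _ => by ring
    have e4 : z * symbol S.r S.p S.a1 κ - symbol S.r S.p S.a0 κ =
        symbol S.r S.p S.a1 κ * (z - Fsym S.r S.p S.a0 S.a1 κ) := by
      unfold Fsym
      have := hs κ hκ'
      field_simp
    change symbol S.r S.p (fun ℓ => z * S.a1 ℓ - S.a0 ℓ) κ *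
      (z - Fsym S.r S.p S.a0 S.a1 κ)⁻¹ = symbol S.r S.p S.a1 κ * 1
    rw [e3, e4, mul_assoc, mul_inv_cancel₀ (hne κ hκ')]
  have e5 := conv_inj S.r S.p S.a1 S.hQ1_ne _ ‖z • G - S.L G - dirac‖
    (fun i => lp.norm_apply_le_norm (by norm_num) _ i) e0
  refine ⟨G, ?_, fun j => ?_⟩
  · rw [← sub_eq_zero]
    ext j
    exact e5 j
  · refine (hGb j).trans_eq ?_
    congr 1
    have : |(j : ℝ)| = (j.natAbs : ℝ) := by rw [Nat.cast_natAbs, Int.cast_abs]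
    rw [this, neg_mul, Real.exp_neg, mul_comm, Real.exp_nat_mul, Real.exp_log (by linarith), inv_pow]
end
end

section
/- Under Assumptions 1–5 in the explicit specialization with K = 1 and α > 0, set δ := α/2. Then there exist constants η > 0 and C > 0 such that for every integer n ≥ 1 and every integer j with 1 ≤ j ≤ n δ, the temporal Green's function satisfies |𝒢ⁿ_j| ≤ C exp(−n η / 4). -/
open scoped Classical
open Complex Filter Asymptotics Metric

noncomputable section

set_option autoImplicit false

lemma aux_strict (G : ℂ → ℂ) (a : ℝ) (ha : 0 < a) (hG : HasStrictDerivAt G (-(a : ℂ)) 0)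
    (hGc : Continuous G) (h0 : G 0 = 1) (hle : ∀ ξ : ℝ, ‖G (ξ * I)‖ ≤ 1)
    (hlt : ∀ ξ ∈ Set.Icc (-Real.pi) Real.pi, ξ ≠ 0 → ‖G ((ξ : ℝ) * I)‖ < 1) :
    ∃ τ > (0 : ℝ), ∃ q > (0 : ℝ), q < 1 ∧
      ∀ ξ ∈ Set.Icc (-Real.pi) Real.pi, ‖G ((τ : ℂ) + (ξ : ℝ) * I)‖ ≤ q := by
  have key : ∀ᶠ τ : ℝ in nhds 0, ∀ ξ ∈ Set.Icc (-Real.pi) Real.pi,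
      0 < τ → ‖G ((τ : ℂ) + (ξ : ℝ) * I)‖ < 1 := by
    apply isCompact_Icc.eventually_forall_of_forall_eventually
    intro ξ hξ
    have hc : Continuous (fun z : ℝ × ℝ => (z.1 : ℂ) + (z.2 : ℂ) * I) := by fun_prop
    by_cases hz : ξ = 0
    · subst hz
      have h1 : Tendsto (fun z : ℝ × ℝ => ((z.1 : ℂ) + (z.2 : ℂ) * I, (z.2 : ℂ) * I))
          (nhds ((0 : ℝ), (0 : ℝ))) (nhds ((0 : ℂ), (0 : ℂ))) := by
        have : Continuous (fun z : ℝ × ℝ => ((z.1 : ℂ) + (z.2 : ℂ) * I, (z.2 : ℂ) * I)) := by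
          fun_prop
        simpa using this.tendsto (0, 0)
      have h2 := h1.eventually (hG.hasStrictFDerivAt.isLittleO.def
        (show 0 < a / 4 by positivity))
      have h3 : ∀ᶠ z : ℝ × ℝ in nhds ((0 : ℝ), (0 : ℝ)), ‖G ((z.2 : ℂ) * I) - 1‖ < 1 / 4 := by
        have : Continuous (fun z : ℝ × ℝ => ‖G ((z.2 : ℂ) * I) - 1‖) := by fun_prop
        exact this.continuousAt.eventually_lt continuousAt_const (by simp [h0])
      have h4 : ∀ᶠ z : ℝ × ℝ in nhds ((0 : ℝ), (0 : ℝ)), a * z.1 < 1 := by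
        have : Continuous (fun z : ℝ × ℝ => a * z.1) := by fun_prop
        exact this.continuousAt.eventually_lt continuousAt_const (by simp)
      filter_upwards [h2, h3, h4] with z hz2 hz3 hz4 hpos
      obtain ⟨t, x⟩ := z
      simp only at hz2 hz3 hz4 hpos ⊢
      set y := G ((x : ℂ) * I) with hy
      have hyle : ‖y‖ ≤ 1 := hle x
      have e1 : G ((t : ℂ) + x * I) = (G ((t : ℂ) + x * I) - y - (t + x * I - x * I) • (-(a : ℂ)))
          + y * ((1 - a * t : ℝ) : ℂ) + ((a * t : ℝ) : ℂ) * (y - 1) := by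
        simp only [smul_eq_mul]; push_cast; ring
      have n1 : ‖((t : ℂ) + x * I - x * I)‖ = t := by
        rw [add_sub_cancel_right, Complex.norm_real, Real.norm_of_nonneg hpos.le]
      rw [n1, ContinuousLinearMap.toSpanSingleton_apply] at hz2
      have n2 : ‖y * ((1 - a * t : ℝ) : ℂ)‖ ≤ 1 - a * t := by
        rw [norm_mul, Complex.norm_real, Real.norm_of_nonneg (by linarith)]
        nlinarith
      have n3 : ‖((a * t : ℝ) : ℂ) * (y - 1)‖ ≤ a * t * (1 / 4) := by
        rw [norm_mul, Complex.norm_real, Real.norm_of_nonneg (by positivity)]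
        gcongr
      rw [e1]
      have hat : 0 < a * t := by positivity
      calc _ ≤ _ := norm_add₃_le
        _ ≤ a / 4 * t + (1 - a * t) + a * t * (1 / 4) := by gcongr
        _ < 1 := by nlinarith
    · have : Continuous (fun z : ℝ × ℝ => ‖G ((z.1 : ℂ) + (z.2 : ℂ) * I)‖) := by fun_prop
      have h := this.continuousAt (x := ((0 : ℝ), ξ)).eventually_lt
        (continuousAt_const (y := (1 : ℝ))) (by simpa using hlt ξ hξ hz)
      filter_upwards [h] with z hz _ using hz
  obtain ⟨τ, hτ1, hτ⟩ := ((key.filter_mono (nhdsWithin_le_nhds (s := Set.Ioi 0))).and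
    self_mem_nhdsWithin).exists
  have hcont : Continuous (fun ξ : ℝ => ‖G ((τ : ℂ) + (ξ : ℝ) * I)‖) := by fun_prop
  obtain ⟨x, hx, hmax⟩ := (isCompact_Icc (a := -Real.pi) (b := Real.pi)).exists_isMaxOn
    ⟨0, by constructor <;> linarith [Real.pi_pos]⟩ hcont.continuousOn
  refine ⟨τ, hτ, max (1 / 2) ‖G ((τ : ℂ) + (x : ℝ) * I)‖, by positivity,
    max_lt (by norm_num) (hτ1 x hx hτ), fun ξ hξ => le_trans (hmax hξ) (le_max_right _ _)⟩

lemma green_integral (r p : ℕ) (a0 : ℤ → ℂ) (L : Seq2 →L[ℂ] Seq2)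
    (hL : ∀ (u : Seq2) (j : ℤ), L u j = convAct r p a0 (fun i => u i) j)
    (s : ℝ) (hs : 0 < s) (n : ℕ) : ∀ j : ℤ,
    (∮ κ in C(0, s), symbol r p a0 κ ^ n * κ ^ (j - 1)) =
      2 * Real.pi * I * ((L ^ n) dirac) j := by
  have hne : ∀ κ ∈ sphere (0 : ℂ) s, κ ≠ 0 := by
    intro κ hκ h
    subst h
    simp at hκ
    exact hs.ne hκ
  have hcz : ∀ m : ℤ, ContinuousOn (fun κ : ℂ => κ ^ m) (sphere 0 s) := fun m κ hκ =>
    (continuousAt_zpow₀ κ m (Or.inl (hne κ hκ))).continuousWithinAt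
  have hcs : ContinuousOn (symbol r p a0) (sphere 0 s) := by
    unfold symbol
    exact continuousOn_finsetSum _ fun i _ => continuousOn_const.mul (hcz i)
  induction n with
  | zero =>
    intro j
    simp only [pow_zero, one_mul]
    by_cases hj : j = 0
    · subst hj
      have := circleIntegral.integral_sub_center_inv (0 : ℂ) hs.ne'
      simp only [sub_zero] at this
      simpa [dirac, lp.single_apply] using this
    · have := circleIntegral.integral_sub_zpow_of_ne (n := j - 1) (by omega) (0 : ℂ) 0 s
      simp only [sub_zero] at this
      rw [this]
      simp [dirac, lp.single_apply, hj]
  | succ n ih =>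
    intro j
    have e : ((L ^ (n + 1)) dirac) j = L ((L ^ n) dirac) j := by
      rw [pow_succ']; rfl
    rw [e, hL, convAct, Finset.mul_sum]
    have e2 : (∮ κ in C(0, s), symbol r p a0 κ ^ (n + 1) * κ ^ (j - 1)) =
        ∮ κ in C(0, s), ∑ ℓ ∈ Finset.Icc (-(r : ℤ)) (p : ℤ),
          a0 ℓ * (symbol r p a0 κ ^ n * κ ^ (j + ℓ - 1)) := by
      apply circleIntegral.integral_congr hs.le
      intro κ hκ
      have hk := hne κ hκ
      simp only
      rw [pow_succ, mul_assoc]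
      nth_rewrite 2 [symbol]
      rw [Finset.sum_mul, Finset.mul_sum]
      refine Finset.sum_congr rfl fun ℓ _ => ?_
      rw [show j + ℓ - 1 = ℓ + (j - 1) by ring, zpow_add₀ hk]
      ring
    rw [e2, circleIntegral.integral_fun_sum]
    · refine Finset.sum_congr rfl fun ℓ _ => ?_
      rw [circleIntegral.integral_const_mul, ih]
      ring
    · intro ℓ _
      exact (continuousOn_const.mul ((hcs.pow n).mul (hcz _))).circleIntegrable hs.le

/-- Lemma 8: in the explicit case with `K = 1` and `α > 0`, setting `δ = α/2`, the temporal
Green's function satisfies `|𝒢ⁿ_j| ≤ C e^{-nη/4}` in the medium range `1 ≤ j ≤ nδ`. -/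
theorem temporal_green_medium_bound
    (r p : ℕ) (hrp : 1 ≤ p + r) (a0 a1 : ℤ → ℂ)
    (α β : ℝ) (μ : ℕ) (hα : 0 < α) (hβ : 0 < β) (hμ : 1 ≤ μ)
    (L : Seq2 →L[ℂ] Seq2)
    -- Assumption 1
    (hQ1_ne : ∀ κ : ℂ, ‖κ‖ = 1 → symbol r p a1 κ ≠ 0)
    (hQ1_index : (2 * (Real.pi : ℂ) * Complex.I)⁻¹ *
      (∮ κ in C(0, 1), deriv (symbol r p a1) κ / symbol r p a1 κ) = 0)
    -- `ℒ = Q₁⁻¹ Q₀` is characterized by `Q₁ ∘ ℒ = Q₀`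
    (hL : ∀ (u : Seq2) (j : ℤ),
      convAct r p a1 (fun i => L u i) j = convAct r p a0 (fun i => u i) j)
    -- explicit case: `Q₁ = I`
    (hQ1id : ∀ ℓ ∈ Finset.Icc (-(r : ℤ)) (p : ℤ), a1 ℓ = if ℓ = 0 then 1 else 0)
    -- Assumption 2 specialized to `K = 1`, `κ̲₁ = 1`, `z̲₁ = F(1) = 1`
    (hF1 : Fsym r p a0 a1 1 = 1)
    (hFlt : ∀ κ : ℂ, ‖κ‖ = 1 → κ ≠ 1 → ‖Fsym r p a0 a1 κ‖ < 1)
    (hexp : ∃ g : ℝ → ℂ, (g =O[nhds 0] fun ξ : ℝ => ξ ^ (2 * μ + 1)) ∧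
      ∀ᶠ ξ : ℝ in nhds 0, Fsym r p a0 a1 (Complex.exp (Complex.I * ξ)) =
        Complex.exp (-(Complex.I) * (α : ℂ) * (ξ : ℂ)
          - (β : ℂ) * (ξ : ℂ) ^ (2 * μ) + g ξ))
    -- Assumption 3
    (hA : ∀ z : ℂ, 1 ≤ ‖z‖ → Acoef a0 a1 (-(r : ℤ)) z ≠ 0 ∧ Acoef a0 a1 (p : ℤ) z ≠ 0)
    : ∃ η > (0 : ℝ), ∃ C > (0 : ℝ), ∀ n : ℕ, 1 ≤ n → ∀ j : ℤ,
      1 ≤ j → (j : ℝ) ≤ (n : ℝ) * (α / 2) →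
      ‖((L ^ n) dirac) j‖ ≤ C * Real.exp (-(n : ℝ) * η / 4) := by
  have hs1 : ∀ κ : ℂ, symbol r p a1 κ = 1 := by
    intro κ
    unfold symbol
    rw [Finset.sum_congr rfl (fun ℓ hℓ => by rw [hQ1id ℓ hℓ])]
    simp
  have hFs : ∀ κ, Fsym r p a0 a1 κ = symbol r p a0 κ := by
    intro κ; simp [Fsym, hs1]
  simp only [hFs] at hF1 hFlt hexp
  have hL' : ∀ (u : Seq2) (j : ℤ), L u j = convAct r p a0 (fun i => u i) j := by
    intro u j
    rw [← hL u j]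
    unfold convAct
    rw [Finset.sum_congr rfl (fun ℓ hℓ => by rw [hQ1id ℓ hℓ])]
    simp
  have hfd : Differentiable ℂ (fun w : ℂ => symbol r p a0 (Complex.exp w)) := by
    unfold symbol
    simp only [← Complex.exp_int_mul]
    fun_prop
  obtain ⟨d, hd⟩ : ∃ d, HasDerivAt (fun w : ℂ => symbol r p a0 (Complex.exp w)) d 0 :=
    ⟨_, (hfd 0).hasDerivAt⟩
  have hdα : d = -(α : ℂ) := by
    obtain ⟨g, hg, hev⟩ := hexp
    have hg0 : g 0 = 0 := by
      obtain ⟨c, hc⟩ := hg.bound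
      simpa using hc.self_of_nhds
    have hgd : HasDerivAt g 0 0 := by
      rw [hasDerivAt_iff_isLittleO]
      simp only [hg0, sub_zero, smul_zero]
      refine hg.trans_isLittleO ?_
      have := isLittleO_pow_pow (𝕜 := ℝ) (show 1 < 2 * μ + 1 by omega)
      simpa using this
    have hid : HasDerivAt (fun ξ : ℝ => (ξ : ℂ)) 1 0 := Complex.ofRealCLM.hasDerivAt
    have hr : HasDerivAt (fun ξ : ℝ => Complex.exp (-(Complex.I) * (α : ℂ) * (ξ : ℂ)
          - (β : ℂ) * (ξ : ℂ) ^ (2 * μ) + g ξ)) (-I * α) 0 := by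
      have h := (((hid.const_mul (-I * (α : ℂ))).sub
        ((hid.pow (2 * μ)).const_mul (β : ℂ))).add hgd).cexp
      have h2 : 2 * μ - 1 ≠ 0 := by omega
      have h3 : μ ≠ 0 := by omega
      refine HasDerivAt.congr_deriv h ?_
      simp [hg0, h2, h3]
    have hl : HasDerivAt (fun ξ : ℝ => symbol r p a0 (Complex.exp (I * ξ))) (d * I) 0 := by
      have hi : HasDerivAt (fun ξ : ℝ => I * (ξ : ℂ)) I 0 := by
        simpa using hid.const_mul I
      have hd' : HasDerivAt (fun w : ℂ => symbol r p a0 (Complex.exp w)) d (I * ((0 : ℝ) : ℂ)) := by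
        simpa using hd
      exact hd'.comp (0 : ℝ) hi
    have h := hl.unique (hr.congr_of_eventuallyEq hev)
    have : d * I = -α * I := by rw [h]; ring
    exact mul_right_cancel₀ I_ne_zero this
  set G : ℂ → ℂ := fun w => symbol r p a0 (Complex.exp w) * Complex.exp (α / 2 * w) with hGdef
  have hGd : Differentiable ℂ G := by
    apply hfd.mul; fun_prop
  have hG0 : HasDerivAt G (-((α / 2 : ℝ) : ℂ)) 0 := by
    have h1 : HasDerivAt (fun w : ℂ => Complex.exp (α / 2 * w)) (α / 2) 0 := by
      simpa using ((hasDerivAt_id (0 : ℂ)).const_mul ((α : ℂ) / 2)).cexp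
    have h2 := hd.mul h1
    refine HasDerivAt.congr_deriv h2 ?_
    simp [hF1, hdα]
    ring
  have hGs : HasStrictDerivAt G (-((α / 2 : ℝ) : ℂ)) 0 := by
    have h := (hGd.contDiff (n := 1)).contDiffAt.hasStrictDerivAt (x := (0 : ℂ)) (by simp)
    rwa [hG0.deriv] at h
  have hGn : ∀ t x : ℝ, ‖G ((t : ℂ) + x * I)‖ =
      ‖symbol r p a0 (Complex.exp ((t : ℂ) + x * I))‖ * Real.exp (α / 2 * t) := by
    intro t x
    simp [hGdef, Complex.norm_exp]
  have hsle : ∀ x : ℝ, ‖symbol r p a0 (Complex.exp (x * I))‖ ≤ 1 := by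
    intro x
    by_cases h : Complex.exp (x * I) = 1
    · rw [h, hF1]; simp
    · exact (hFlt _ (Complex.norm_exp_ofReal_mul_I x) h).le
  obtain ⟨τ, hτ, q, hq0, hq1, hq⟩ := aux_strict G (α / 2) (by positivity) hGs hGd.continuous
    (by simp [hGdef, hF1])
    (fun ξ => by have := hGn 0 ξ; simp at this; rw [this]; exact hsle ξ)
    (fun ξ hξ h0 => by
      have := hGn 0 ξ
      simp at this
      rw [this]
      refine hFlt _ (Complex.norm_exp_ofReal_mul_I ξ) fun h => h0 ?_
      rw [Complex.exp_eq_one_iff] at h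
      obtain ⟨m, hm⟩ := h
      have hm' : ξ = m * (2 * Real.pi) := by
        have h3 : (ξ : ℂ) * I = ((m * (2 * Real.pi) : ℝ) : ℂ) * I := by
          rw [hm]; push_cast; ring
        exact_mod_cast mul_right_cancel₀ I_ne_zero h3
      have hpi := Real.pi_pos
      have m1 : m < 1 := by
        by_contra hc
        have : (1 : ℝ) ≤ m := by exact_mod_cast not_lt.1 hc
        nlinarith [hξ.2]
      have m2 : -1 < m := by
        by_contra hc
        have : (m : ℝ) ≤ -1 := by exact_mod_cast not_lt.1 hc
        nlinarith [hξ.1]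
      have : m = 0 := by omega
      simp [hm', this])
  refine ⟨-4 * Real.log q, by nlinarith [Real.log_neg hq0 hq1], 1, one_pos, ?_⟩
  intro n _ j _ hj
  have hrhs : Real.exp (-(n : ℝ) * (-4 * Real.log q) / 4) = q ^ n := by
    rw [show -(n : ℝ) * (-4 * Real.log q) / 4 = n * Real.log q by ring, Real.exp_nat_mul,
      Real.exp_log hq0]
  rw [hrhs, one_mul]
  have hs : 0 < Real.exp τ := Real.exp_pos τ
  have hint := green_integral r p a0 L hL' (Real.exp τ) hs n j
  have hM : ∀ κ ∈ sphere (0 : ℂ) (Real.exp τ),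
      ‖symbol r p a0 κ‖ ≤ q * Real.exp (-(α / 2 * τ)) := by
    intro κ hκ
    have hk : ‖κ‖ = Real.exp τ := by simpa using hκ
    have hk2 : κ = Complex.exp ((τ : ℂ) + κ.arg * I) := by
      rw [Complex.exp_add, ← Complex.ofReal_exp, ← hk, Complex.norm_mul_exp_arg_mul_I]
    have h := hq κ.arg ⟨(Complex.neg_pi_lt_arg κ).le, Complex.arg_le_pi κ⟩
    rw [hGn, ← hk2] at h
    rw [Real.exp_neg, ← div_eq_mul_inv, le_div_iff₀ (Real.exp_pos _)]
    exact h
  have hb : ∀ κ ∈ sphere (0 : ℂ) (Real.exp τ),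
      ‖symbol r p a0 κ ^ n * κ ^ (j - 1)‖ ≤ q ^ n * Real.exp (-τ) := by
    intro κ hκ
    have hk : ‖κ‖ = Real.exp τ := by simpa using hκ
    rw [norm_mul, norm_pow, norm_zpow, hk, ← Real.rpow_intCast, ← Real.exp_mul, mul_comm τ]
    calc _ ≤ (q * Real.exp (-(α / 2 * τ))) ^ n * Real.exp (((j - 1 : ℤ) : ℝ) * τ) := by
          gcongr; exact hM κ hκ
      _ = q ^ n * Real.exp (n * (-(α / 2 * τ)) + ((j - 1 : ℤ) : ℝ) * τ) := by
          rw [mul_pow, ← Real.exp_nat_mul, Real.exp_add, mul_assoc]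
      _ ≤ q ^ n * Real.exp (-τ) := by
          gcongr
          push_cast
          nlinarith
  have hfin := circleIntegral.norm_integral_le_of_norm_le_const hs.le hb
  rw [hint, norm_mul] at hfin
  have hn : ‖(2 * (Real.pi : ℂ) * I)‖ = 2 * Real.pi := by
    simp [abs_of_pos Real.pi_pos]
  have hee : Real.exp τ * Real.exp (-τ) = 1 := by rw [← Real.exp_add]; simp
  rw [hn, show 2 * Real.pi * Real.exp τ * (q ^ n * Real.exp (-τ)) =
    2 * Real.pi * (q ^ n * (Real.exp τ * Real.exp (-τ))) by ring, hee, mul_one] at hfin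
  exact le_of_mul_le_mul_left hfin (by positivity)
end
end
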